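/- Assume the Riemann Hypothesis: every zero of the Riemann zeta function with real part strictly between 0 and 1 has real part 1/2. Let B = (1/2)·log(4π) − 1 − γ/2, where γ is the Euler–Mascheroni constant. Then for every real x ≥ e, |∑_{n ≤ x} (Λ(n)/(n·log n))·(log(x/n)/log x) − (log log x + γ − 1 + γ/log x)| ≤ 2|B|/(√x·(log x)²) + 1/(3·x³·(log x)²). -/

import Mathlib

open scoped ArithmeticFunction

section

open Real Set Filter Topology MeasureTheory

theorem eq_zero_of_integral_exp_mul_eq_zero {f : ℝ → ℝ} (hc : ContinuousOn f (Ici 0))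
    (ht : Tendsto (fun u => exp (-u) * f u) atTop (𝓝 0))
    (hi : IntegrableOn (fun u => exp (-u) * f u) (Ioi 0))
    (h0 : ∀ n : ℕ, ∫ u in Ioi 0, exp (-u) ^ n * (exp (-u) * f u) = 0) {u : ℝ} (hu : 0 ≤ u) :
    f u = 0 := by
  -- `g` is `u ↦ exp (-u) * f u` in the variable `exp (-u)`.
  set g : ℝ → ℝ := fun y => y * f (-log y) with hg
  have hgexp : ∀ u, g (exp (-u)) = exp (-u) * f u := fun u => by simp [hg]
  have hgc : ContinuousOn g (Icc 0 1) := by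
    intro y hy
    rcases hy.1.eq_or_lt with rfl | hpos
    · have h1 : Tendsto g (𝓝[>] 0) (𝓝 0) := by
        have := ht.comp (tendsto_neg_atBot_atTop.comp tendsto_log_nhdsGT_zero)
        refine this.congr' ?_
        filter_upwards [self_mem_nhdsWithin] with y hy
        simp [hg, exp_log hy]
      have h2 : ContinuousWithinAt g (Ioi 0) 0 := by
        simpa [ContinuousWithinAt, hg] using h1
      have h3 : ContinuousWithinAt g (Ici 0) 0 := by
        rw [← Ioi_insert]; exact h2.insert
      exact h3.mono Icc_subset_Ici_self
    · refine ContinuousWithinAt.mul continuousWithinAt_id ?_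
      have : ContinuousWithinAt (fun y => -log y) (Icc 0 1) y :=
        (continuousAt_log hpos.ne').neg.continuousWithinAt
      refine ContinuousWithinAt.comp (t := Ici 0) (hc _ ?_) this ?_
      · simpa using log_nonpos hy.1 hy.2
      · intro z hz
        simpa using log_nonpos hz.1 hz.2
  have hpoly : ∀ P : Polynomial ℝ,
      ∫ u in Ioi 0, P.eval (exp (-u)) * (exp (-u) * f u) = 0 := by
    intro P
    have hinteg : ∀ n : ℕ, IntegrableOn (fun u => exp (-u) ^ n * (exp (-u) * f u)) (Ioi 0) := by
      intro n
      refine hi.bdd_mul (c := 1) (by fun_prop) ?_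
      filter_upwards [ae_restrict_mem measurableSet_Ioi] with u hu
      have : exp (-u) ≤ 1 := by simpa using (mem_Ioi.mp hu).le
      rw [norm_pow, norm_of_nonneg (exp_pos _).le]
      exact pow_le_one₀ (exp_pos _).le this
    simp_rw [Polynomial.eval_eq_sum_range, Finset.sum_mul, mul_assoc]
    rw [integral_finsetSum _ fun i _ => (hinteg i).const_mul _]
    simp_rw [integral_const_mul, h0, mul_zero, Finset.sum_const_zero]
  have hsq : ∫ u in Ioi 0, (exp (-u) * f u) ^ 2 = 0 := by
    set I := ∫ u in Ioi 0, |exp (-u) * f u|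
    have hI : 0 ≤ I := integral_nonneg fun _ => abs_nonneg _
    have key : ∀ ε > 0, |∫ u in Ioi 0, (exp (-u) * f u) ^ 2| ≤ ε * I := by
      intro ε hε
      obtain ⟨P, hP⟩ := exists_polynomial_near_of_continuousOn 0 1 g hgc ε hε
      have hle : ∀ u ∈ Ioi (0 : ℝ), |exp (-u) * f u - P.eval (exp (-u))| ≤ ε := by
        intro u hu
        have := hP (exp (-u)) ⟨(exp_pos _).le, by simpa using (mem_Ioi.mp hu).le⟩
        rw [hgexp, abs_sub_comm] at this
        exact this.le
      have hmeas : AEStronglyMeasurable (fun u => exp (-u) * f u - P.eval (exp (-u)))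
          (volume.restrict (Ioi 0)) :=
        hi.aestronglyMeasurable.sub (by fun_prop)
      have hinteg1 : IntegrableOn
          (fun u => (exp (-u) * f u - P.eval (exp (-u))) * (exp (-u) * f u)) (Ioi 0) := by
        refine hi.bdd_mul (c := ε) hmeas ?_
        filter_upwards [ae_restrict_mem measurableSet_Ioi] with u hu using hle u hu
      have hinteg2 : IntegrableOn (fun u => P.eval (exp (-u)) * (exp (-u) * f u)) (Ioi 0) := by
        obtain ⟨C, hC⟩ := isCompact_Icc.exists_bound_of_continuousOn
          (P.continuous.continuousOn (s := Icc (0 : ℝ) 1))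
        refine hi.bdd_mul (c := C) (by fun_prop) ?_
        filter_upwards [ae_restrict_mem measurableSet_Ioi] with u hu
        exact hC _ ⟨(exp_pos _).le, by simpa using (mem_Ioi.mp hu).le⟩
      have heq : ∫ u in Ioi 0, (exp (-u) * f u) ^ 2 =
          ∫ u in Ioi 0, (exp (-u) * f u - P.eval (exp (-u))) * (exp (-u) * f u) := by
        have hadd := integral_add hinteg1 hinteg2
        rw [hpoly P, add_zero] at hadd
        rw [← hadd]
        congr 1 with u
        ring
      rw [heq, ← integral_const_mul]
      refine (abs_integral_le_integral_abs).trans ?_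
      refine integral_mono_ae hinteg1.abs (hi.abs.const_mul _) ?_
      filter_upwards [ae_restrict_mem measurableSet_Ioi] with u hu
      rw [abs_mul]
      gcongr
      exact hle u hu
    by_contra hne
    have hpos : 0 < |∫ u in Ioi 0, (exp (-u) * f u) ^ 2| := abs_pos.mpr hne
    have := key (|∫ u in Ioi 0, (exp (-u) * f u) ^ 2| / (2 * (I + 1))) (by positivity)
    rw [div_mul_eq_mul_div, le_div_iff₀ (by positivity)] at this
    nlinarith
  have hcont : ContinuousOn (fun u => exp (-u) * f u) (Ici 0) := by fun_prop
  have hsqint : IntegrableOn (fun u => (exp (-u) * f u) ^ 2) (Ioi 0) := by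
    obtain ⟨C, hC⟩ := isCompact_Icc.exists_bound_of_continuousOn hgc
    simp_rw [pow_two]
    refine hi.bdd_mul (c := C) hi.aestronglyMeasurable ?_
    filter_upwards [ae_restrict_mem measurableSet_Ioi] with u hu
    have := hC (exp (-u)) ⟨(exp_pos _).le, by simpa using (mem_Ioi.mp hu).le⟩
    rwa [hgexp] at this
  have hae : (fun u => (exp (-u) * f u) ^ 2) =ᵐ[volume.restrict (Ici 0)] 0 := by
    rw [Measure.restrict_congr_set Ioi_ae_eq_Ici.symm]
    exact (setIntegral_eq_zero_iff_of_nonneg_ae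
      (Eventually.of_forall fun _ => sq_nonneg _) hsqint).mp hsq
  have := Measure.eqOn_of_ae_eq hae (hcont.pow 2) continuousOn_const (by simp [closure_Ioi])
  simpa using this (mem_Ici.mpr hu)

theorem exists_eq_pow_mul_of_ne_zero {g : ℂ → ℂ} (hg : Differentiable ℂ g)
    {w : ℂ} (hw : g w ≠ 0) (a : ℂ) :
    ∃ n : ℕ, ∃ k : ℂ → ℂ, Differentiable ℂ k ∧ k a ≠ 0 ∧ ∀ z, g z = (z - a) ^ n * k z := by
  obtain ⟨p, hp⟩ := hg.analyticAt a
  have hp0 : p ≠ 0 := by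
    intro h
    have hev : ∀ᶠ z in 𝓝 a, g z = 0 := hp.locally_zero_iff.mpr h
    have han : AnalyticOnNhd ℂ g univ := fun z _ => hg.analyticAt z
    exact hw (han.eqOn_zero_of_preconnected_of_eventuallyEq_zero isPreconnected_univ
      (mem_univ a) hev (mem_univ w))
  refine ⟨p.order, (Function.swap dslope a)^[p.order] g, ?_,
    hp.iterate_dslope_fslope_ne_zero hp0, fun z => ?_⟩
  · induction p.order with
    | zero => simpa using hg
    | succ n ih =>
      rw [Function.iterate_succ_apply', ← differentiableOn_univ]
      exact (Complex.differentiableOn_dslope univ_mem).mpr ih.differentiableOn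
  · simpa using hp.eq_pow_order_mul_iterate_dslope z

theorem exists_eq_prod_pow_mul {h : ℂ → ℂ} (hd : Differentiable ℂ h)
    {w : ℂ} (hw : h w ≠ 0) (S : Finset ℂ) :
    ∃ k : ℂ → ℂ, Differentiable ℂ k ∧ (∀ a ∈ S, k a ≠ 0) ∧
      ∀ z, h z = (∏ a ∈ S, (z - a) ^ analyticOrderNatAt h a) * k z := by
  classical
  obtain ⟨m, k, hk, hkS, hhk⟩ : ∃ m : ℂ → ℕ, ∃ k : ℂ → ℂ, Differentiable ℂ k ∧
      (∀ a ∈ S, k a ≠ 0) ∧ ∀ z, h z = (∏ a ∈ S, (z - a) ^ m a) * k z := by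
    induction S using Finset.induction_on with
    | empty => exact ⟨0, h, hd, by simp, by simp⟩
    | insert b S hb ih =>
      obtain ⟨m, k, hk, hkS, hhk⟩ := ih
      have hkw : k w ≠ 0 := fun h0 => hw (by rw [hhk w, h0, mul_zero])
      obtain ⟨n, k', hk', hkb, hkk'⟩ := exists_eq_pow_mul_of_ne_zero hk hkw b
      refine ⟨Function.update m b n, k', hk', ?_, fun z => ?_⟩
      · intro a ha h0
        rcases Finset.mem_insert.mp ha with rfl | ha
        · exact hkb h0
        · exact hkS a ha (by rw [hkk' a, h0, mul_zero])
      · have : ∏ a ∈ S, (z - a) ^ Function.update m b n a = ∏ a ∈ S, (z - a) ^ m a :=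
          Finset.prod_congr rfl fun a ha => by
            rw [Function.update_of_ne (ne_of_mem_of_not_mem ha hb)]
        rw [Finset.prod_insert hb, hhk z, hkk' z, Function.update_self, this]
        ring
  refine ⟨k, hk, hkS, fun z => ?_⟩
  rw [hhk z]
  congr 1
  refine Finset.prod_congr rfl fun a ha => ?_
  congr 1
  have hfac : ∀ z, h z = (z - a) ^ m a • ((∏ b ∈ S.erase a, (z - b) ^ m b) * k z) := by
    intro z
    rw [hhk z, ← Finset.mul_prod_erase S _ ha, smul_eq_mul, mul_assoc]
  have hdiff : Differentiable ℂ fun z => (∏ b ∈ S.erase a, (z - b) ^ m b) * k z :=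
    (Differentiable.fun_finsetProd fun b _ => by fun_prop).mul hk
  have hord : analyticOrderAt h a = m a := by
    refine ((hd.analyticAt a).analyticOrderAt_eq_natCast).mpr
      ⟨_, hdiff.analyticAt a, ?_, Eventually.of_forall hfac⟩
    refine mul_ne_zero (Finset.prod_ne_zero_iff.mpr fun b hb => pow_ne_zero _ ?_) (hkS a ha)
    exact sub_ne_zero.mpr (Finset.ne_of_mem_erase hb).symm
  simp [analyticOrderNatAt, hord]

theorem finite_zeros_inter_closedBall {h : ℂ → ℂ} (hd : Differentiable ℂ h)
    {w : ℂ} (hw : h w ≠ 0) (c : ℂ) (R : ℝ) : (Metric.closedBall c R ∩ h ⁻¹' {0}).Finite := by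
  have han : AnalyticOnNhd ℂ h univ := fun z _ => hd.analyticAt z
  have hcod : h ⁻¹' {0}ᶜ ∈ codiscrete ℂ := by
    exact han.preimage_zero_mem_codiscreteWithin hw (mem_univ w) isConnected_univ
  have hcl := mem_codiscrete'.mp hcod
  simp only [preimage_compl, isOpen_compl_iff, compl_compl] at hcl
  exact ((isCompact_closedBall c R).inter_right hcl.1).finite (hcl.2.mono inter_subset_right)

/-- A zero-free holomorphic function on a ball with `log ‖k‖ ≤ M` has `log ‖k‖` small well inside
the ball. -/
theorem abs_log_norm_le_of_ne_zero {k : ℂ → ℂ} {w z : ℂ} {R M : ℝ} (hk : Differentiable ℂ k)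
    (hkw : k w = 1) (hM : 0 < M) (hne : ∀ z ∈ Metric.ball w R, k z ≠ 0)
    (hb : ∀ z ∈ Metric.ball w R, ‖k z‖ ≤ exp M) (hz : ‖z - w‖ < R) :
    |log ‖k z‖| ≤ 2 * M * ‖z - w‖ / (R - ‖z - w‖) := by
  have hR : 0 < R := (norm_nonneg _).trans_lt hz
  have hderiv : Differentiable ℂ (deriv k) := hk.contDiff.differentiable_deriv_two
  have hq : DifferentiableOn ℂ (fun z => deriv k z / k z) (Metric.ball w R) :=
    hderiv.differentiableOn.div hk.differentiableOn hne
  obtain ⟨L, hL0, hL⟩ := hq.isExactOn_ball.with_val_at w 0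
  have hexp : ∀ z ∈ Metric.ball w R, k z = Complex.exp (L z) := by
    have hconst : ∀ z ∈ Metric.ball w R, HasDerivAt (fun z => k z * Complex.exp (-L z)) 0 z := by
      intro z hz
      refine ((hk z).hasDerivAt.mul (hL z hz).neg.cexp).congr_deriv ?_
      rw [mul_left_comm, mul_neg, mul_div_cancel₀ _ (hne z hz), mul_comm, ← mul_add,
        add_neg_cancel, mul_zero]
    intro z hz
    have := Metric.isOpen_ball.is_const_of_deriv_eq_zero (𝕜 := ℂ)
      (Metric.isConnected_ball hR).isPreconnected
      (fun z hz => (hconst z hz).differentiableAt.differentiableWithinAt)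
      (fun z hz => (hconst z hz).deriv) hz (Metric.mem_ball_self hR)
    simp only [hkw, hL0, neg_zero, Complex.exp_zero, mul_one] at this
    rw [Complex.exp_neg, ← div_eq_mul_inv, div_eq_one_iff_eq (Complex.exp_ne_zero _)] at this
    exact this
  have hre : ∀ z ∈ Metric.ball w R, log ‖k z‖ = (L z).re := by
    intro z hz
    rw [hexp z hz, Complex.norm_exp, log_exp]
  have hmem : ∀ v ∈ Metric.ball (0 : ℂ) R, w + v ∈ Metric.ball w R := by
    intro v hv
    simpa using hv
  have hBC := Complex.borelCaratheodory_zero (f := fun v => L (w + v)) (z := z - w) hM (R := R)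
    (fun v hv => by
      have := (hL (w + v) (hmem v hv)).differentiableAt
      exact (this.comp v (by fun_prop)).differentiableWithinAt)
    (fun v hv => by
      have h1 := hre _ (hmem v hv)
      have h2 : log ‖k (w + v)‖ ≤ M := by
        rw [log_le_iff_le_exp (norm_pos_iff.mpr (hne _ (hmem v hv)))]
        exact hb _ (hmem v hv)
      simpa [← h1] using h2) hR (by simpa using hz) (by simpa using hL0)
  rw [add_sub_cancel] at hBC
  rw [hre z (by simpa [dist_eq_norm] using hz)]
  exact (Complex.abs_re_le_norm _).trans hBC

/-- Genus zero Hadamard factorization, in terms of `log ‖·‖`: the partial products over discs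
converge. -/
theorem tendsto_sum_log_norm_sub_zeros {h : ℂ → ℂ} (hd : Differentiable ℂ h)
    {w : ℂ} (hw : h w ≠ 0) {α C : ℝ} (hC : 0 ≤ C) (hα0 : 0 ≤ α) (hα : α < 1)
    (hgr : ∀ z, ‖h z‖ ≤ exp (C * (1 + ‖z‖) ^ α)) {z : ℂ} (hz : h z ≠ 0) :
    Tendsto (fun R : ℝ => ∑ a ∈ (finite_zeros_inter_closedBall hd hw w R).toFinset,
      (analyticOrderNatAt h a : ℝ) * log (‖z - a‖ / ‖w - a‖)) atTop
      (𝓝 (log (‖h z‖ / ‖h w‖))) := by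
  set r := ‖z - w‖ with hr
  set M : ℝ → ℝ := fun R => C * (1 + ‖w‖ + 2 * R) ^ α + |log ‖h w‖| + 1 with hM
  have hlim : Tendsto (fun R => 2 * M R * r / (R - r)) atTop (𝓝 0) := by
    have h1 : Tendsto (fun R => M R / R) atTop (𝓝 0) := by
      have hlo : (fun R : ℝ => (1 + ‖w‖ + 2 * R) ^ α) =o[atTop] fun R => R := by
        have h2 : (fun R : ℝ => R ^ α) =o[atTop] fun R : ℝ => R := by
          rw [Asymptotics.isLittleO_iff_tendsto' ((eventually_gt_atTop 0).mono fun R hR h0 =>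
            absurd h0 hR.ne')]
          refine (tendsto_rpow_neg_atTop (sub_pos.mpr hα)).congr' ?_
          filter_upwards [eventually_gt_atTop 0] with R hR
          rw [neg_sub, rpow_sub_one hR.ne']
        have ht : Tendsto (fun R : ℝ => 1 + ‖w‖ + 2 * R) atTop atTop :=
          tendsto_atTop_add_const_left _ _ (tendsto_id.const_mul_atTop two_pos)
        have h3 := h2.comp_tendsto ht
        simp only [Function.comp_def] at h3
        refine h3.trans_isBigO ?_
        refine Asymptotics.IsBigO.of_bound (3 + ‖w‖) ?_
        filter_upwards [eventually_ge_atTop 1] with R hR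
        rw [norm_of_nonneg (by positivity), norm_of_nonneg (by positivity)]
        nlinarith [norm_nonneg w]
      have hc : (fun _ : ℝ => |log ‖h w‖| + 1) =o[atTop] fun R : ℝ => R :=
        Asymptotics.isLittleO_const_id_atTop _
      have := ((hlo.const_mul_left C).add hc).tendsto_div_nhds_zero
      refine this.congr fun R => ?_
      simp only [hM]
      ring
    have h2 : Tendsto (fun R : ℝ => R / (R - r)) atTop (𝓝 1) := by
      have : Tendsto (fun R : ℝ => 1 + r / (R - r)) atTop (𝓝 (1 + 0)) :=
        (tendsto_const_nhds.div_atTop (tendsto_atTop_add_const_right _ _ tendsto_id)).const_add 1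
      rw [add_zero] at this
      refine this.congr' ?_
      filter_upwards [eventually_gt_atTop r] with R hR
      have : R - r ≠ 0 := (sub_pos.mpr hR).ne'
      field_simp
      ring
    have h3 := ((h1.mul h2).const_mul 2).mul_const r
    simp only [mul_one, mul_zero, zero_mul] at h3
    refine h3.congr' ?_
    filter_upwards [eventually_gt_atTop r, eventually_gt_atTop 0] with R hR hR0
    have : R - r ≠ 0 := (sub_pos.mpr hR).ne'
    field_simp
  rw [tendsto_iff_norm_sub_tendsto_zero]
  refine squeeze_zero' (Eventually.of_forall fun _ => norm_nonneg _) ?_ hlim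
  filter_upwards [eventually_gt_atTop r, eventually_gt_atTop 0] with R hrR hR0
  set S := (finite_zeros_inter_closedBall hd hw w R).toFinset with hS
  have hmemS : ∀ a, a ∈ S ↔ ‖a - w‖ ≤ R ∧ h a = 0 := by
    intro a
    simp [hS, dist_eq_norm]
  obtain ⟨g, hg, hgS, hhg⟩ := exists_eq_prod_pow_mul hd hw S
  have hgne : ∀ {v}, h v ≠ 0 → g v ≠ 0 := fun {v} hv h0 => hv (by rw [hhg v, h0, mul_zero])
  have hgw := hgne hw
  set k : ℂ → ℂ := fun v => g v / g w with hk
  have hkd : Differentiable ℂ k := hg.div_const _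
  have hneS : ∀ {v}, h v ≠ 0 → ∀ a ∈ S, ‖v - a‖ ≠ 0 := by
    intro v hv a ha h0
    rw [norm_eq_zero, sub_eq_zero] at h0
    exact hv (h0 ▸ ((hmemS a).mp ha).2)
  have hprod : ∀ v, ‖h v‖ / ‖h w‖ =
      (∏ a ∈ S, (‖v - a‖ / ‖w - a‖) ^ analyticOrderNatAt h a) * ‖k v‖ := by
    intro v
    rw [hhg v, hhg w, norm_mul, norm_mul, norm_prod, norm_prod, mul_div_mul_comm,
      ← Finset.prod_div_distrib, hk, norm_div]
    simp_rw [norm_pow, div_pow]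
  have hsphere : ∀ v ∈ frontier (Metric.ball w (2 * R)), ‖k v‖ ≤ exp (M R) := by
    intro v hv
    have hv : ‖v - w‖ = 2 * R := by
      have := Metric.frontier_ball_subset_sphere hv
      simpa [dist_eq_norm] using this
    have hP : 1 ≤ ∏ a ∈ S, (‖v - a‖ / ‖w - a‖) ^ analyticOrderNatAt h a := by
      refine Finset.one_le_prod fun a ha => one_le_pow₀ ?_
      rw [one_le_div ((norm_nonneg _).lt_of_ne' (hneS hw a ha))]
      have h1 := ((hmemS a).mp ha).1
      have h2 := norm_sub_le_norm_sub_add_norm_sub v a w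
      rw [norm_sub_rev w a]
      linarith
    have h1 : ‖k v‖ ≤ ‖h v‖ / ‖h w‖ := by
      rw [hprod v]
      exact le_mul_of_one_le_left (norm_nonneg _) hP
    refine h1.trans ?_
    have hhw : 0 < ‖h w‖ := norm_pos_iff.mpr hw
    rw [div_le_iff₀ hhw]
    refine (hgr v).trans ?_
    have hMw : exp (M R) * ‖h w‖ = exp (M R + log ‖h w‖) := by
      rw [exp_add (M R) (log ‖h w‖), exp_log hhw]
    rw [hMw]
    refine exp_le_exp.mpr ?_
    have h2 : ‖v‖ ≤ ‖w‖ + 2 * R := by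
      rw [← hv]; simpa using norm_add_le w (v - w)
    have h3 : C * (1 + ‖v‖) ^ α ≤ C * (1 + ‖w‖ + 2 * R) ^ α := by
      gcongr 2
      linarith
    simp only [hM]
    linarith [neg_abs_le (log ‖h w‖)]
  have hball : ∀ v ∈ Metric.ball w R, ‖k v‖ ≤ exp (M R) := by
    intro v hv
    refine Complex.norm_le_of_forall_mem_frontier_norm_le Metric.isBounded_ball
      hkd.diffContOnCl hsphere (subset_closure ?_)
    exact Metric.ball_subset_ball (by linarith) hv
  have hne : ∀ v ∈ Metric.ball w R, k v ≠ 0 := by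
    intro v hv
    refine div_ne_zero ?_ hgw
    by_cases h0 : h v = 0
    · exact hgS v ((hmemS v).mpr ⟨by simpa [dist_eq_norm] using (Metric.mem_ball.mp hv).le, h0⟩)
    · exact hgne h0
  have hfin := abs_log_norm_le_of_ne_zero hkd (div_self hgw)
    (by simp only [hM]; positivity) hne hball hrR
  have hsum : log (‖h z‖ / ‖h w‖) =
      (∑ a ∈ S, (analyticOrderNatAt h a : ℝ) * log (‖z - a‖ / ‖w - a‖)) + log ‖k z‖ := by
    rw [hprod z, log_mul, log_prod]
    · simp_rw [log_pow]
    · exact fun a ha => pow_ne_zero _ (div_ne_zero (hneS hz a ha) (hneS hw a ha))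
    · exact Finset.prod_ne_zero_iff.mpr fun a ha =>
        pow_ne_zero _ (div_ne_zero (hneS hz a ha) (hneS hw a ha))
    · exact norm_ne_zero_iff.mpr (div_ne_zero (hgne hz) hgw)
  rw [hsum, sub_add_cancel_left, norm_neg]
  exact hfin

theorem exists_norm_mellin_le {f : ℝ → ℂ} {a b : ℝ} (ha : MellinConvergent f a)
    (hb : MellinConvergent f b) :
    ∃ K : ℝ, 0 ≤ K ∧ ∀ s : ℂ, a ≤ s.re → s.re ≤ b → ‖mellin f s‖ ≤ K := by
  have hn : ∀ (s : ℂ) {t : ℝ}, t ∈ Ioi (0 : ℝ) →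
      ‖(t : ℂ) ^ (s - 1) • f t‖ = t ^ (s.re - 1) * ‖f t‖ := by
    intro s t ht
    rw [norm_smul, Complex.norm_cpow_eq_rpow_re_of_pos ht]
    simp
  have hg : IntegrableOn (fun t : ℝ => t ^ (a - 1) * ‖f t‖ + t ^ (b - 1) * ‖f t‖) (Ioi 0) := by
    refine (((Integrable.norm ha).congr ?_)).add ((Integrable.norm hb).congr ?_)
    · filter_upwards [ae_restrict_mem measurableSet_Ioi] with t ht
      simpa using hn a ht
    · filter_upwards [ae_restrict_mem measurableSet_Ioi] with t ht
      simpa using hn b ht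
  refine ⟨∫ t in Ioi (0 : ℝ), (t ^ (a - 1) * ‖f t‖ + t ^ (b - 1) * ‖f t‖),
    setIntegral_nonneg measurableSet_Ioi fun t (ht : 0 < t) => by positivity, fun s h1 h2 => ?_⟩
  refine norm_integral_le_of_norm_le hg ?_
  filter_upwards [ae_restrict_mem measurableSet_Ioi] with t ht
  rw [hn s ht, ← add_mul]
  refine mul_le_mul_of_nonneg_right ?_ (norm_nonneg _)
  have ht' : (0 : ℝ) < t := ht
  have e1 : 0 < t ^ (a - 1) := rpow_pos_of_pos ht' _
  have e2 : 0 < t ^ (b - 1) := rpow_pos_of_pos ht' _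
  rcases le_total t 1 with h | h
  · have := rpow_le_rpow_of_exponent_ge ht' h (by linarith : a - 1 ≤ s.re - 1)
    linarith
  · have := rpow_le_rpow_of_exponent_le h (by linarith : s.re - 1 ≤ b - 1)
    linarith

theorem exists_norm_completedRiemannZeta₀_le (a b : ℝ) :
    ∃ K : ℝ, 0 ≤ K ∧ ∀ s : ℂ, a ≤ s.re → s.re ≤ b → ‖completedRiemannZeta₀ s‖ ≤ K := by
  have hconv := fun s : ℂ =>
    ((HurwitzZeta.hurwitzEvenFEPair 0).isStrongFEPair_toStrongFEPair.hasMellin s).1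
  obtain ⟨K, hK, hle⟩ := exists_norm_mellin_le (hconv (a / 2 : ℝ)) (hconv (b / 2 : ℝ))
  refine ⟨K / 2, by positivity, fun s h1 h2 => ?_⟩
  have hre : (s / 2).re = s.re / 2 := by simp
  have := hle (s / 2) (by rw [hre]; linarith) (by rw [hre]; linarith)
  have e : completedRiemannZeta₀ s =
    mellin (HurwitzZeta.hurwitzEvenFEPair 0).toStrongFEPair.f (s / 2) / 2 := rfl
  rw [e, norm_div, Complex.norm_ofNat]
  linarith

theorem norm_Gamma_le_Gamma_re {s : ℂ} (hs : 0 < s.re) :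
    ‖Complex.Gamma s‖ ≤ Real.Gamma s.re := by
  rw [Complex.Gamma_eq_integral hs, Complex.GammaIntegral, Real.Gamma_eq_integral hs]
  refine norm_integral_le_of_norm_le (Real.GammaIntegral_convergent hs) ?_
  filter_upwards [ae_restrict_mem measurableSet_Ioi] with t ht
  rw [norm_mul, Complex.norm_cpow_eq_rpow_re_of_pos ht, Complex.norm_real,
    norm_of_nonneg (exp_pos _).le]
  simp

theorem Gamma_le_exp_rpow {x : ℝ} (hx : 1 ≤ x) :
    Real.Gamma x ≤ exp (2 * (1 + x) ^ (3 / 2 : ℝ)) := by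
  have hx0 : 0 < x := by linarith
  set n := ⌈x⌉₊ with hn
  have hxn : x ≤ n := Nat.le_ceil x
  have hn1 : (n : ℝ) ≤ 1 + x := by rw [add_comm]; exact (Nat.ceil_lt_add_one hx0.le).le
  have hnpos : (0 : ℝ) < n := by linarith
  have h1 : Real.Gamma x ≤ Real.Gamma (x + 1) := by
    rw [Real.Gamma_add_one hx0.ne']
    exact le_mul_of_one_le_left (Real.Gamma_pos_of_pos hx0).le hx
  have h2 : Real.Gamma (x + 1) ≤ Real.Gamma (n + 1) :=
    Real.Gamma_strictMonoOn_Ici.monotoneOn (by simp; linarith) (by simp; linarith) (by linarith)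
  have h3 : (n.factorial : ℝ) ≤ (n : ℝ) ^ n := by exact_mod_cast Nat.factorial_le_pow n
  rw [Real.Gamma_nat_eq_factorial] at h2
  refine (h1.trans (h2.trans h3)).trans ?_
  rw [← rpow_natCast, rpow_def_of_pos hnpos]
  refine exp_le_exp.mpr ?_
  have h4 := log_le_rpow_div hnpos.le (by norm_num : (0 : ℝ) < 1 / 2)
  calc log n * n ≤ ((n : ℝ) ^ (1 / 2 : ℝ) / (1 / 2)) * n := by gcongr
    _ = 2 * (n : ℝ) ^ (3 / 2 : ℝ) := by
      rw [show (3 / 2 : ℝ) = 1 / 2 + 1 by norm_num, rpow_add_one hnpos.ne']; ring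
    _ ≤ 2 * (1 + x) ^ (3 / 2 : ℝ) := by gcongr

/-- The entire function `s (s - 1) π ^ (-s / 2) Γ(s / 2) ζ(s)`, twice Riemann's `ξ`. -/
noncomputable def riemannXi (s : ℂ) : ℂ := 1 + s * (s - 1) * completedRiemannZeta₀ s

theorem differentiable_riemannXi : Differentiable ℂ riemannXi := by
  have := differentiable_completedZeta₀
  unfold riemannXi
  fun_prop

theorem riemannXi_one_sub (s : ℂ) : riemannXi (1 - s) = riemannXi s := by
  rw [riemannXi, riemannXi, completedRiemannZeta₀_one_sub]
  ring

theorem riemannXi_eq {s : ℂ} (h0 : s ≠ 0) (h1 : s ≠ 1) (hG : s.Gammaℝ ≠ 0) :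
    riemannXi s = s * (s - 1) * (s.Gammaℝ * riemannZeta s) := by
  have h1' : 1 - s ≠ 0 := sub_ne_zero.mpr h1.symm
  rw [riemannZeta_def_of_ne_zero h0, mul_div_cancel₀ _ hG, completedRiemannZeta_eq, riemannXi]
  field_simp
  ring

theorem exists_norm_riemannXi_le : ∃ C : ℝ, 0 ≤ C ∧ ∀ s : ℂ, 1 / 2 ≤ s.re →
    ‖riemannXi s‖ ≤ exp (C * (1 + ‖s‖) ^ (3 / 2 : ℝ)) := by
  obtain ⟨K, hK, hKle⟩ := exists_norm_completedRiemannZeta₀_le (1 / 2) 2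
  have hZs : Summable fun n : ℕ => 1 / ((n : ℝ) + 1) ^ 2 := by
    exact_mod_cast (summable_nat_add_iff 1).mpr (Real.summable_one_div_nat_pow.mpr one_lt_two)
  set Z := ∑' n : ℕ, 1 / ((n : ℝ) + 1) ^ 2 with hZ
  have hZ0 : 0 ≤ Z := tsum_nonneg fun n => by positivity
  have hpow : ∀ s : ℂ, (1 + ‖s‖) ^ 2 ≤ exp (2 * (1 + ‖s‖) ^ (3 / 2 : ℝ)) := by
    intro s
    have h1 : 1 + ‖s‖ ≤ exp ((1 + ‖s‖) ^ (3 / 2 : ℝ)) := by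
      have e1 : 1 + ‖s‖ ≤ (1 + ‖s‖) ^ (3 / 2 : ℝ) :=
        self_le_rpow_of_one_le (by linarith [norm_nonneg s]) (by norm_num)
      linarith [add_one_le_exp ((1 + ‖s‖) ^ (3 / 2 : ℝ))]
    calc (1 + ‖s‖) ^ 2 ≤ exp ((1 + ‖s‖) ^ (3 / 2 : ℝ)) ^ 2 := by gcongr
      _ = _ := by rw [← exp_nat_mul]; norm_num
  have hexp : ∀ (A : ℝ) (s : ℂ), 0 ≤ A → A ≤ exp (A * (1 + ‖s‖) ^ (3 / 2 : ℝ)) := by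
    intro A s hA
    have e1 : 1 ≤ (1 + ‖s‖) ^ (3 / 2 : ℝ) :=
      one_le_rpow (by linarith [norm_nonneg s]) (by norm_num)
    have e2 : A ≤ A * (1 + ‖s‖) ^ (3 / 2 : ℝ) := le_mul_of_one_le_right hA e1
    linarith [add_one_le_exp (A * (1 + ‖s‖) ^ (3 / 2 : ℝ))]
  have hss : ∀ s : ℂ, ‖s * (s - 1)‖ ≤ (1 + ‖s‖) ^ 2 := by
    intro s
    have : ‖s - 1‖ ≤ ‖s‖ + 1 := by simpa using norm_sub_le s 1
    rw [norm_mul, sq]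
    gcongr <;> linarith
  refine ⟨2 + (1 + K) + Z + 2, by positivity, fun s hs => ?_⟩
  have hpos : 0 ≤ (1 + ‖s‖) ^ (3 / 2 : ℝ) := by positivity
  rcases le_total s.re 2 with h2 | h2
  · have h3 := hKle s hs h2
    calc ‖riemannXi s‖ ≤ 1 + ‖s * (s - 1)‖ * ‖completedRiemannZeta₀ s‖ := by
          rw [riemannXi, ← norm_mul]; simpa using norm_add_le 1 (s * (s - 1) * completedRiemannZeta₀ s)
      _ ≤ (1 + ‖s‖) ^ 2 + (1 + ‖s‖) ^ 2 * K := by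
          gcongr
          · exact one_le_pow₀ (by linarith [norm_nonneg s])
          · exact hss s
      _ = (1 + ‖s‖) ^ 2 * (1 + K) := by ring
      _ ≤ exp (2 * (1 + ‖s‖) ^ (3 / 2 : ℝ)) * exp ((1 + K) * (1 + ‖s‖) ^ (3 / 2 : ℝ)) := by
          gcongr
          · exact hpow s
          · exact hexp _ s (by positivity)
      _ ≤ _ := by
          rw [← exp_add]
          refine exp_le_exp.mpr ?_
          nlinarith [mul_nonneg hZ0 hpos]
  · have hs1 : s ≠ 1 := by rintro rfl; norm_num at h2
    have hs0 : s ≠ 0 := by rintro rfl; norm_num at h2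
    have hzeta : ‖riemannZeta s‖ ≤ Z := by
      rw [zeta_eq_tsum_one_div_nat_add_one_cpow (by linarith)]
      refine tsum_of_norm_bounded hZs.hasSum fun n => ?_
      have hn : (0 : ℝ) < (n : ℝ) + 1 := by positivity
      have e : ((n : ℂ) + 1) = ((n : ℝ) + 1 : ℝ) := by push_cast; rfl
      rw [e, norm_div, norm_one, Complex.norm_cpow_eq_rpow_re_of_pos hn]
      refine one_div_le_one_div_of_le (by positivity) ?_
      rw [← rpow_two]
      exact rpow_le_rpow_of_exponent_le (by linarith [(Nat.cast_nonneg n : (0 : ℝ) ≤ n)]) h2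
    have hre : (s / 2).re = s.re / 2 := by simp
    have hGam : ‖s.Gammaℝ‖ ≤ exp (2 * (1 + ‖s‖) ^ (3 / 2 : ℝ)) := by
      rw [Complex.Gammaℝ_def, norm_mul, Complex.norm_cpow_eq_rpow_re_of_pos pi_pos]
      have e1 : π ^ (-s / 2).re ≤ 1 :=
        rpow_le_one_of_one_le_of_nonpos (by linarith [pi_gt_three]) (by simp; linarith)
      have e2 := norm_Gamma_le_Gamma_re (s := s / 2) (by rw [hre]; linarith)
      have e3 := Gamma_le_exp_rpow (x := (s / 2).re) (by rw [hre]; linarith)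
      have e4 : (1 + (s / 2).re) ^ (3 / 2 : ℝ) ≤ (1 + ‖s‖) ^ (3 / 2 : ℝ) := by
        have := Complex.re_le_norm s
        refine rpow_le_rpow (by rw [hre]; linarith) (by rw [hre]; linarith) (by norm_num)
      calc _ ≤ 1 * exp (2 * (1 + ‖s‖) ^ (3 / 2 : ℝ)) := by
            refine mul_le_mul e1 ((e2.trans e3).trans (exp_le_exp.mpr (by linarith)))
              (norm_nonneg _) zero_le_one
        _ = _ := one_mul _
    rw [riemannXi_eq hs0 hs1 (Complex.Gammaℝ_ne_zero_of_re_pos (by linarith)), norm_mul, norm_mul s.Gammaℝ]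
    calc _ ≤ exp (2 * (1 + ‖s‖) ^ (3 / 2 : ℝ)) * (exp (2 * (1 + ‖s‖) ^ (3 / 2 : ℝ)) *
          exp (Z * (1 + ‖s‖) ^ (3 / 2 : ℝ))) := by
          gcongr
          · exact (hss s).trans (hpow s)
          · exact hzeta.trans (hexp _ s hZ0)
      _ ≤ _ := by
          rw [← exp_add, ← exp_add]
          refine exp_le_exp.mpr ?_
          nlinarith [mul_nonneg hK hpos]

/-- The entire function `h` with `h (z ^ 2) = riemannXi (1 / 2 + z)`. -/
noncomputable def riemannXiSqrt (w : ℂ) : ℂ := riemannXi (1 / 2 + w ^ (1 / 2 : ℂ))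

theorem riemannXi_half_add_eq_of_sq_eq {z z' : ℂ} (h : z ^ 2 = z' ^ 2) :
    riemannXi (1 / 2 + z) = riemannXi (1 / 2 + z') := by
  rcases sq_eq_sq_iff_eq_or_eq_neg.mp h with rfl | rfl
  · rfl
  · rw [← riemannXi_one_sub]
    congr 1
    ring

theorem cpow_half_sq (w : ℂ) : (w ^ (1 / 2 : ℂ)) ^ 2 = w := by
  simp

theorem riemannXiSqrt_sq (z : ℂ) : riemannXiSqrt (z ^ 2) = riemannXi (1 / 2 + z) :=
  riemannXi_half_add_eq_of_sq_eq (cpow_half_sq _)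

theorem differentiable_riemannXiSqrt : Differentiable ℂ riemannXiSqrt := by
  have hd := differentiable_riemannXi
  rw [← differentiableOn_univ,
    ← Complex.differentiableOn_compl_singleton_and_continuousAt_iff (c := 0) univ_mem]
  refine ⟨fun w hw => DifferentiableAt.differentiableWithinAt ?_, ?_⟩
  · have hw0 : w ≠ 0 := by simpa using hw
    rcases Complex.mem_slitPlane_or_neg_mem_slitPlane hw0 with h | h
    · have : DifferentiableAt ℂ (fun w : ℂ => 1 / 2 + w ^ (1 / 2 : ℂ)) w :=
        (differentiableAt_id.cpow_const h).const_add _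
      exact (hd _).comp w this
    · have h1 : DifferentiableAt ℂ (fun w : ℂ => 1 / 2 + Complex.I * (-w) ^ (1 / 2 : ℂ)) w :=
        ((differentiableAt_id.neg.cpow_const h).const_mul _).const_add _
      have h2 : riemannXiSqrt = fun w => riemannXi (1 / 2 + Complex.I * (-w) ^ (1 / 2 : ℂ)) := by
        funext w
        refine riemannXi_half_add_eq_of_sq_eq ?_
        rw [mul_pow, cpow_half_sq, cpow_half_sq, Complex.I_sq]
        ring
      rw [h2]
      exact (hd _).comp w h1
  · have h0 : ContinuousAt (fun w : ℂ => 1 / 2 + w ^ (1 / 2 : ℂ)) 0 := by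
      refine continuousAt_const.add ?_
      refine Complex.continuousAt_cpow_const_of_re_pos (Or.inl (by simp)) (by norm_num)
    exact ContinuousAt.comp (f := fun w : ℂ => 1 / 2 + w ^ (1 / 2 : ℂ)) (g := riemannXi)
      hd.continuous.continuousAt h0

theorem exists_norm_riemannXiSqrt_le : ∃ C : ℝ, 0 ≤ C ∧ ∀ w : ℂ,
    ‖riemannXiSqrt w‖ ≤ exp (C * (1 + ‖w‖) ^ (3 / 4 : ℝ)) := by
  obtain ⟨C, hC, hle⟩ := exists_norm_riemannXi_le
  refine ⟨C * 3 ^ (3 / 2 : ℝ), by positivity, fun w => ?_⟩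
  set z := w ^ (1 / 2 : ℂ) with hz
  have hre : 0 ≤ z.re := by
    have h1 := Complex.arg_le_pi w
    have h2 := Complex.neg_pi_lt_arg w
    rcases eq_or_ne w 0 with rfl | hw
    · simp [hz]
    rw [hz, Complex.cpow_def_of_ne_zero hw, Complex.exp_re]
    refine mul_nonneg (exp_pos _).le (Real.cos_nonneg_of_neg_pi_div_two_le_of_le ?_ ?_)
    · simp [Complex.log_im]; linarith
    · simp [Complex.log_im]; linarith
  have hn : ‖z‖ ^ 2 = ‖w‖ := by rw [← norm_pow, cpow_half_sq]
  refine (hle (1 / 2 + z) (by simpa using hre)).trans (exp_le_exp.mpr ?_)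
  rw [mul_assoc]
  refine mul_le_mul_of_nonneg_left ?_ hC
  have h1 : ‖1 / 2 + z‖ ≤ 1 / 2 + ‖z‖ := by
    simpa using norm_add_le (1 / 2 : ℂ) z
  have h2 : 1 + ‖1 / 2 + z‖ ≤ 3 * √(1 + ‖w‖) := by
    have : (1 + ‖z‖) ≤ 2 * √(1 + ‖w‖) := by
      rw [← hn]
      refine abs_le_of_sq_le_sq' ?_ (by positivity) |>.2
      rw [mul_pow, sq_sqrt (by positivity)]
      nlinarith [sq_nonneg (1 - ‖z‖), norm_nonneg z]
    have : 1 ≤ √(1 + ‖w‖) := one_le_sqrt.mpr (by linarith [norm_nonneg w])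
    linarith
  calc (1 + ‖1 / 2 + z‖) ^ (3 / 2 : ℝ) ≤ (3 * √(1 + ‖w‖)) ^ (3 / 2 : ℝ) := by gcongr
    _ = 3 ^ (3 / 2 : ℝ) * (1 + ‖w‖) ^ (3 / 4 : ℝ) := by
      rw [mul_rpow (by norm_num) (by positivity), sqrt_eq_rpow, ← rpow_mul (by positivity)]
      norm_num

theorem riemannXi_one : riemannXi 1 = 1 := by simp [riemannXi]

theorem riemannXi_ne_zero_of_one_le_re {s : ℂ} (hs : 1 ≤ s.re) : riemannXi s ≠ 0 := by
  rcases eq_or_ne s 1 with rfl | h1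
  · simp [riemannXi_one]
  have h0 : s ≠ 0 := by rintro rfl; norm_num at hs
  have hG : s.Gammaℝ ≠ 0 := Complex.Gammaℝ_ne_zero_of_re_pos (by linarith)
  rw [riemannXi_eq h0 h1 hG]
  exact mul_ne_zero (mul_ne_zero h0 (sub_ne_zero.mpr h1))
    (mul_ne_zero hG (riemannZeta_ne_zero_of_one_le_re hs))

theorem re_eq_half_of_riemannXi_eq_zero
    (RH : ∀ s : ℂ, riemannZeta s = 0 → 0 < s.re → s.re < 1 → s.re = 1 / 2)
    {s : ℂ} (hs : riemannXi s = 0) : s.re = 1 / 2 := by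
  have h1 : s.re < 1 := by
    by_contra! h
    exact riemannXi_ne_zero_of_one_le_re h hs
  have h2 : 0 < s.re := by
    by_contra! h
    refine riemannXi_ne_zero_of_one_le_re (s := 1 - s) (by simpa using h) ?_
    rwa [riemannXi_one_sub]
  have hs0 : s ≠ 0 := by rintro rfl; norm_num at h2
  have hs1 : s ≠ 1 := by rintro rfl; norm_num at h1
  have hG : s.Gammaℝ ≠ 0 := Complex.Gammaℝ_ne_zero_of_re_pos h2
  refine RH s ?_ h2 h1
  rw [riemannXi_eq hs0 hs1 hG] at hs
  simpa [hs0, hG, sub_eq_zero, hs1] using hs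

theorem exists_eq_neg_of_riemannXiSqrt_eq_zero
    (RH : ∀ s : ℂ, riemannZeta s = 0 → 0 < s.re → s.re < 1 → s.re = 1 / 2)
    {w : ℂ} (hw : riemannXiSqrt w = 0) : w.re ≤ 0 ∧ w = (w.re : ℂ) := by
  have h := re_eq_half_of_riemannXi_eq_zero RH hw
  have h0 : (w ^ (1 / 2 : ℂ)).re = 0 := by
    rw [Complex.add_re] at h
    norm_num at h
    simpa using h
  have h1 := cpow_half_sq w
  set z := w ^ (1 / 2 : ℂ)
  have hre : w.re = - z.im ^ 2 := by rw [← h1, sq, Complex.mul_re, h0]; ring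
  have him : w.im = 0 := by rw [← h1, sq, Complex.mul_im, h0]; ring
  exact ⟨by rw [hre]; nlinarith, by apply Complex.ext <;> simp [him]⟩

theorem riemannXiSqrt_quarter : riemannXiSqrt (1 / 4) = 1 := by
  have := riemannXiSqrt_sq (1 / 2)
  norm_num at this
  rw [this, riemannXi_one]

theorem countable_riemannXiSqrt_zeros : Countable {w : ℂ // riemannXiSqrt w = 0} := by
  have hw : riemannXiSqrt (1 / 4) ≠ 0 := by rw [riemannXiSqrt_quarter]; exact one_ne_zero
  have h : (riemannXiSqrt ⁻¹' {0}) =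
      ⋃ n : ℕ, Metric.closedBall (0 : ℂ) n ∩ riemannXiSqrt ⁻¹' {0} := by
    rw [← iUnion_inter, Metric.iUnion_closedBall_nat, univ_inter]
  have hc : (riemannXiSqrt ⁻¹' {0}).Countable := by
    rw [h]
    exact countable_iUnion fun n =>
      (finite_zeros_inter_closedBall differentiable_riemannXiSqrt hw 0 n).countable
  exact hc.to_subtype

theorem hasSum_log_norm_riemannXi
    (RH : ∀ s : ℂ, riemannZeta s = 0 → 0 < s.re → s.re < 1 → s.re = 1 / 2) :
    ∃ (m t : {w : ℂ // riemannXiSqrt w = 0} → ℝ), (∀ i, 0 ≤ m i) ∧ (∀ i, 0 ≤ t i) ∧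
      ∀ s : ℝ, 0 ≤ s → HasSum (fun i => m i * log (((s + 1 / 2) ^ 2 + t i) / (1 / 4 + t i)))
        (log ‖riemannXi (1 + s)‖) := by
  set h := riemannXiSqrt with hh
  have hw : h (1 / 4) ≠ 0 := by rw [hh, riemannXiSqrt_quarter]; exact one_ne_zero
  have hord : ∀ a, h a ≠ 0 → analyticOrderNatAt h a = 0 := by
    intro a ha
    by_contra h0
    exact ha (apply_eq_zero_of_analyticOrderNatAt_ne_zero h0)
  obtain ⟨C, hC, hgr⟩ := exists_norm_riemannXiSqrt_le
  refine ⟨fun i => analyticOrderNatAt h i, fun i => -(i : ℂ).re, fun i => Nat.cast_nonneg _,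
    fun i => by linarith [(exists_eq_neg_of_riemannXiSqrt_eq_zero RH i.2).1], fun s hs => ?_⟩
  have hval : h ((1 / 2 + s) ^ 2) = riemannXi (1 + s) := by
    rw [hh, riemannXiSqrt_sq]; congr 1; ring
  have hz : h ((1 / 2 + s) ^ 2) ≠ 0 := by
    rw [hval]
    exact riemannXi_ne_zero_of_one_le_re (by simpa using hs)
  have hlim := tendsto_sum_log_norm_sub_zeros differentiable_riemannXiSqrt hw hC (by norm_num)
    (by norm_num) hgr hz
  have hval' : log (‖riemannXiSqrt ((1 / 2 + s) ^ 2)‖ / ‖riemannXiSqrt (1 / 4)‖) =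
      log ‖riemannXi (1 + s)‖ := by rw [riemannXiSqrt_quarter, ← hval, norm_one, div_one]
  rw [hval'] at hlim
  set f : ℂ → ℝ := fun a =>
    (analyticOrderNatAt h a : ℝ) * log (‖(1 / 2 + s : ℂ) ^ 2 - a‖ / ‖(1 / 4 : ℂ) - a‖) with hf
  have hfa : ∀ a, h a = 0 → f a =
      (analyticOrderNatAt h a : ℝ) * log (((s + 1 / 2) ^ 2 + -a.re) / (1 / 4 + -a.re)) := by
    intro a ha
    obtain ⟨h1, h2⟩ := exists_eq_neg_of_riemannXiSqrt_eq_zero RH ha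
    have e1 : ((1 / 2 + s : ℂ) ^ 2 - a) = (((s + 1 / 2) ^ 2 + -a.re : ℝ) : ℂ) := by
      rw [h2]; push_cast; simp; ring
    have e2 : ((1 / 4 : ℂ) - a) = ((1 / 4 + -a.re : ℝ) : ℂ) := by
      rw [h2]; push_cast; simp; ring
    rw [hf]
    simp only
    rw [e1, e2, Complex.norm_real, Complex.norm_real, norm_of_nonneg (by nlinarith),
      norm_of_nonneg (by linarith)]
  have hf0 : ∀ a, h a ≠ 0 → f a = 0 := fun a ha => by simp [hf, hord a ha]
  have hfn : ∀ a, 0 ≤ f a := by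
    intro a
    by_cases ha : h a = 0
    · rw [hfa a ha]
      have h1 := (exists_eq_neg_of_riemannXiSqrt_eq_zero RH ha).1
      refine mul_nonneg (Nat.cast_nonneg _) (log_nonneg ?_)
      rw [one_le_div (by linarith)]
      nlinarith
    · rw [hf0 a ha]
  have hle : ∀ F : Finset ℂ, ∑ a ∈ F, f a ≤ log ‖riemannXi (1 + s)‖ := by
    intro F
    refine ge_of_tendsto hlim ?_
    filter_upwards [eventually_ge_atTop (∑ a ∈ F, ‖a - 1 / 4‖)] with R hR
    rw [← Finset.sum_filter_ne_zero]
    refine Finset.sum_le_sum_of_subset_of_nonneg (fun a ha => ?_) fun a _ _ => hfn a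
    rw [Finset.mem_filter] at ha
    have ha0 : h a = 0 := by
      by_contra h0
      exact ha.2 (hf0 a h0)
    have := Finset.single_le_sum (f := fun a : ℂ => ‖a - 1 / 4‖) (fun a _ => norm_nonneg _) ha.1
    simp only [Finite.mem_toFinset, mem_inter_iff, Metric.mem_closedBall, dist_eq_norm]
    exact ⟨this.trans hR, ha0⟩
  have hsum : Summable f := summable_of_sum_le hfn hle
  have hT : ∑' a, f a = log ‖riemannXi (1 + s)‖ :=
    le_antisymm (hsum.tsum_le_of_sum_le hle)
      (le_of_tendsto hlim (Eventually.of_forall fun R => hsum.sum_le_tsum _ fun a _ => hfn a))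
  have hHS : HasSum f (log ‖riemannXi (1 + s)‖) := hT ▸ hsum.hasSum
  have hsub : Function.support f ⊆ {w | h w = 0} := by
    intro a ha
    by_contra h0
    exact ha (hf0 a h0)
  have := (hasSum_subtype_iff_of_support_subset hsub).mpr hHS
  refine HasSum.congr_fun this fun i => ?_
  exact (hfa i.1 i.2).symm

theorem hasDerivAt_riemannXi_one : HasDerivAt riemannXi (completedRiemannZeta₀ 1) 1 := by
  have h1 : HasDerivAt completedRiemannZeta₀ (deriv completedRiemannZeta₀ 1) 1 :=
    (differentiable_completedZeta₀ 1).hasDerivAt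
  have h2 : HasDerivAt (fun s : ℂ => s * (s - 1)) 1 1 := by
    have := (hasDerivAt_id (1 : ℂ)).mul ((hasDerivAt_id (1 : ℂ)).sub_const 1)
    exact this.congr_deriv (by simp)
  exact ((h2.mul h1).const_add 1).congr_deriv (by simp)

theorem tendsto_log_norm_riemannXi_div :
    Tendsto (fun s : ℝ => log ‖riemannXi (1 + s)‖ / s) (𝓝[>] 0)
      (𝓝 ((eulerMascheroniConstant - log (4 * π)) / 2 + 1)) := by
  have h1 : HasDerivAt (fun s : ℂ => riemannXi (1 + s)) (completedRiemannZeta₀ 1) ((0 : ℝ) : ℂ) := by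
    have := hasDerivAt_riemannXi_one
    refine HasDerivAt.comp_const_add (1 : ℂ) _ ?_
    simpa using this
  have h2 : HasDerivAt (fun s : ℝ => Complex.log (riemannXi (1 + s)))
      (completedRiemannZeta₀ 1 / riemannXi (1 + (0 : ℝ))) 0 :=
    h1.comp_ofReal.clog_real (by simp [riemannXi_one])
  have h3 : HasDerivAt (fun s : ℝ => (Complex.log (riemannXi (1 + s))).re)
      ((completedRiemannZeta₀ 1 / riemannXi (1 + (0 : ℝ))).re) 0 :=
    Complex.reCLM.hasFDerivAt.comp_hasDerivAt (0 : ℝ) h2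
  have h4 := h3.tendsto_slope_zero_right
  have h5 : (completedRiemannZeta₀ 1 / riemannXi (1 + (0 : ℝ))).re =
      (eulerMascheroniConstant - log (4 * π)) / 2 + 1 := by
    rw [completedRiemannZeta₀_one]
    have : (((eulerMascheroniConstant : ℂ) - Complex.log (4 * π)) / 2 + 1) =
      (((eulerMascheroniConstant - log (4 * π)) / 2 + 1 : ℝ) : ℂ) := by
      push_cast
      rw [Complex.ofReal_log (by positivity)]
      push_cast
      rfl
    simp only [Complex.ofReal_zero, add_zero, riemannXi_one, div_one]
    rw [this, Complex.ofReal_re]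
  rw [h5] at h4
  refine h4.congr fun s => ?_
  simp [Complex.log_re, riemannXi_one, div_eq_inv_mul]

theorem hasSum_div_quarter_add {ι : Type*} {m t : ι → ℝ} (hm : ∀ i, 0 ≤ m i) (ht : ∀ i, 0 ≤ t i)
    {φ : ℝ → ℝ} {c : ℝ}
    (hφ : ∀ s : ℝ, 0 ≤ s → HasSum (fun i => m i * log (((s + 1 / 2) ^ 2 + t i) / (1 / 4 + t i)))
      (φ s)) (hc : Tendsto (fun s => φ s / s) (𝓝[>] 0) (𝓝 c)) :
    HasSum (fun i => m i / (1 / 4 + t i)) c := by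
  have hn : ∀ i, 0 ≤ m i / (1 / 4 + t i) := fun i => by have := hm i; have := ht i; positivity
  have hle : ∀ F : Finset ι, ∑ i ∈ F, m i / (1 / 4 + t i) ≤ c := by
    intro F
    have hlim : Tendsto (fun s : ℝ => ∑ i ∈ F, m i * ((1 + s) / ((s + 1 / 2) ^ 2 + t i))) (𝓝[>] 0)
        (𝓝 (∑ i ∈ F, m i / (1 / 4 + t i))) := by
      refine tendsto_finsetSum _ fun i _ => ?_
      have : ContinuousAt (fun s : ℝ => m i * ((1 + s) / ((s + 1 / 2) ^ 2 + t i))) 0 := by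
        have : ((0 : ℝ) + 1 / 2) ^ 2 + t i ≠ 0 := by have := ht i; positivity
        fun_prop (disch := assumption)
      have h2 := this.tendsto.mono_left (nhdsWithin_le_nhds (s := Ioi 0))
      convert! h2 using 2
      norm_num
      ring
    refine le_of_tendsto_of_tendsto hlim hc ?_
    filter_upwards [self_mem_nhdsWithin] with s (hs : 0 < s)
    rw [le_div_iff₀ hs, Finset.sum_mul]
    refine le_trans (Finset.sum_le_sum fun i _ => ?_)
      (sum_le_hasSum F (fun i _ => ?_) (hφ s hs.le))
    · have h1 := ht i
      rw [mul_assoc]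
      refine mul_le_mul_of_nonneg_left ?_ (hm i)
      refine le_trans (le_of_eq ?_) (one_sub_inv_le_log_of_pos (by positivity))
      have : (s + 1 / 2) ^ 2 + t i ≠ 0 := by positivity
      field_simp
      ring
    · have h1 := ht i
      refine mul_nonneg (hm i) (log_nonneg ?_)
      rw [one_le_div (by linarith)]
      nlinarith
  have hsum := summable_of_sum_le hn hle
  have h1 : c ≤ ∑' i, m i / (1 / 4 + t i) := by
    have hlim : Tendsto (fun s : ℝ => (1 + s) * ∑' i, m i / (1 / 4 + t i)) (𝓝[>] 0)
        (𝓝 (∑' i, m i / (1 / 4 + t i))) := by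
      have : ContinuousAt (fun s : ℝ => (1 + s) * ∑' i, m i / (1 / 4 + t i)) 0 := by fun_prop
      have h2 := this.tendsto.mono_left (nhdsWithin_le_nhds (s := Ioi 0))
      simpa using h2
    refine le_of_tendsto_of_tendsto hc hlim ?_
    filter_upwards [self_mem_nhdsWithin] with s (hs : 0 < s)
    rw [div_le_iff₀ hs, mul_right_comm]
    refine hasSum_le (fun i => ?_) (hφ s hs.le) (hsum.hasSum.mul_left ((1 + s) * s))
    have h1 := ht i
    rw [show (1 + s) * s * (m i / (1 / 4 + t i)) = m i * ((1 + s) * s / (1 / 4 + t i)) by ring]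
    refine mul_le_mul_of_nonneg_left ?_ (hm i)
    refine (log_le_sub_one_of_pos (by positivity)).trans (le_of_eq ?_)
    field_simp
    ring
  have h2 := hsum.tsum_le_of_sum_le hle
  rw [le_antisymm h1 h2]
  exact hsum.hasSum

theorem sum_one_div_two_mul_add_one (N : ℕ) :
    ∑ m ∈ Finset.range N, 1 / (2 * (m : ℝ) + 1) = harmonic (2 * N) - harmonic N / 2 := by
  induction N with
  | zero => simp
  | succ n ih =>
    rw [Finset.sum_range_succ, ih, mul_add, mul_one, harmonic_succ, harmonic_succ, harmonic_succ]
    push_cast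
    have h1 : 2 * (n : ℝ) + 1 ≠ 0 := by positivity
    have h2 : (n : ℝ) + 1 ≠ 0 := by positivity
    have h3 : 2 * (n : ℝ) + 1 + 1 ≠ 0 := by positivity
    field_simp
    ring

theorem tendsto_sum_one_div_two_mul_add_three :
    Tendsto (fun n : ℕ => ∑ m ∈ Finset.range (n + 1), 1 / (2 * (m : ℝ) + 3) - log n / 2) atTop
      (𝓝 (eulerMascheroniConstant / 2 + log 2 - 1)) := by
  have hH := tendsto_harmonic_sub_log
  have h2 : Tendsto (fun n : ℕ => 2 * (n + 2)) atTop atTop :=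
    tendsto_atTop_mono (fun n => by simp only [id]; omega) tendsto_id
  have h3 : Tendsto (fun n : ℕ => n + 2) atTop atTop :=
    tendsto_atTop_mono (fun n => by simp only [id]; omega) tendsto_id
  have h4 : Tendsto (fun n : ℕ => log (1 + 2 / (n : ℝ))) atTop (𝓝 0) := by
    have : Tendsto (fun n : ℕ => 1 + 2 / (n : ℝ)) atTop (𝓝 (1 + 0)) :=
      (tendsto_const_div_atTop_nhds_zero_nat 2).const_add 1
    rw [add_zero] at this
    simpa using this.log one_ne_zero
  have h5 := (((hH.comp h2).sub ((hH.comp h3).div_const 2)).add (h4.div_const 2)).add_const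
    (log 2 - 1)
  have e : eulerMascheroniConstant - eulerMascheroniConstant / 2 + 0 / 2 + (log 2 - 1) =
    eulerMascheroniConstant / 2 + log 2 - 1 := by ring
  rw [e] at h5
  refine h5.congr' ?_
  filter_upwards [eventually_gt_atTop 0] with n hn
  have hn' : (0 : ℝ) < n := by exact_mod_cast hn
  have h6 : ∑ m ∈ Finset.range (n + 1), 1 / (2 * (m : ℝ) + 3) =
      harmonic (2 * (n + 2)) - harmonic (n + 2) / 2 - 1 := by
    rw [← sum_one_div_two_mul_add_one, Finset.sum_range_succ' _ (n + 1)]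
    simp only [Nat.cast_zero, mul_zero, zero_add, div_one, add_sub_cancel_right]
    refine Finset.sum_congr rfl fun m _ => ?_
    congr 1
    push_cast
    ring
  rw [h6]
  have h7 : log (1 + 2 / (n : ℝ)) = log (n + 2) - log n := by
    rw [← log_div (by positivity) hn'.ne']
    congr 1
    field_simp
  simp only [Function.comp_apply, h7]
  push_cast
  rw [log_mul two_ne_zero (by positivity)]
  ring

theorem hasSum_sub_log_one_add_div_odd {s : ℝ} (hs : 0 ≤ s) :
    HasSum (fun n : ℕ => s / (2 * n + 3) - log (1 + s / (2 * n + 3)))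
      ((log (4 * π) / 2 - 1 + eulerMascheroniConstant / 2) * s +
        log (2 * π ^ (-(1 + s) / 2) * Real.Gamma ((3 + s) / 2))) := by
  have hnn : ∀ n : ℕ, 0 ≤ s / (2 * (n : ℝ) + 3) - log (1 + s / (2 * n + 3)) := fun n => by
    have := log_le_sub_one_of_pos (x := 1 + s / (2 * (n : ℝ) + 3)) (by positivity)
    linarith
  rw [hasSum_iff_tendsto_nat_of_nonneg hnn, ← tendsto_add_atTop_iff_nat 1]
  have h1 := BohrMollerup.tendsto_log_gamma (x := (3 + s) / 2) (by positivity)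
  have h2 := BohrMollerup.tendsto_log_gamma (x := 3 / 2) (by positivity)
  have h3 := ((tendsto_sum_one_div_two_mul_add_three.const_mul s).add h1).sub h2
  have hG : Real.Gamma (3 / 2) = √π / 2 := by
    rw [show (3 / 2 : ℝ) = 1 / 2 + 1 by norm_num, Real.Gamma_add_one (by norm_num),
      Real.Gamma_one_half_eq]
    ring
  have e : s * (eulerMascheroniConstant / 2 + log 2 - 1) + log (Real.Gamma ((3 + s) / 2)) -
      log (Real.Gamma (3 / 2)) = (log (4 * π) / 2 - 1 + eulerMascheroniConstant / 2) * s +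
        log (2 * π ^ (-(1 + s) / 2) * Real.Gamma ((3 + s) / 2)) := by
    have hGp : 0 < Real.Gamma ((3 + s) / 2) := Real.Gamma_pos_of_pos (by positivity)
    rw [hG, log_mul (by positivity) hGp.ne',
      log_mul two_ne_zero (rpow_pos_of_pos pi_pos _).ne',
      log_rpow pi_pos, log_div (by positivity) two_ne_zero, log_sqrt pi_pos.le,
      log_mul four_ne_zero pi_pos.ne', show (4 : ℝ) = 2 ^ 2 by norm_num, log_pow]
    push_cast
    ring
  rw [e] at h3
  refine h3.congr fun n => ?_
  simp only [BohrMollerup.logGammaSeq]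
  rw [mul_sub, Finset.mul_sum, Finset.sum_sub_distrib]
  have h4 : ∑ m ∈ Finset.range (n + 1), log (1 + s / (2 * (m : ℝ) + 3)) =
      ∑ m ∈ Finset.range (n + 1), log ((3 + s) / 2 + m) -
        ∑ m ∈ Finset.range (n + 1), log (3 / 2 + m) := by
    rw [← Finset.sum_sub_distrib]
    refine Finset.sum_congr rfl fun m _ => ?_
    rw [← log_div (by positivity) (by positivity)]
    congr 1
    field_simp
    ring
  rw [h4]
  simp only [mul_one_div]
  ring

theorem log_norm_riemannZeta_one_add {s : ℝ} (hs : 0 < s) :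
    log ‖riemannZeta (1 + s)‖ = log ‖riemannXi (1 + s)‖ - log s -
      log (2 * π ^ (-(1 + s) / 2) * Real.Gamma ((3 + s) / 2)) := by
  have hG : ((1 + s : ℝ) : ℂ).Gammaℝ = ((π ^ (-(1 + s) / 2) * Real.Gamma ((1 + s) / 2) : ℝ) : ℂ) := by
    rw [Complex.Gammaℝ_def]
    push_cast
    rw [Complex.ofReal_cpow pi_pos.le, ← Complex.Gamma_ofReal]
    push_cast
    rfl
  have hpos : 0 < π ^ (-(1 + s) / 2) * Real.Gamma ((1 + s) / 2) :=
    mul_pos (rpow_pos_of_pos pi_pos _) (Real.Gamma_pos_of_pos (by positivity))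
  have hG0 : ((1 + s : ℝ) : ℂ).Gammaℝ ≠ 0 := by
    rw [hG]; exact_mod_cast hpos.ne'
  have hz : riemannZeta (1 + s) ≠ 0 := riemannZeta_ne_zero_of_one_le_re (by simp [hs.le])
  have e1 : ((1 : ℂ) + s) = ((1 + s : ℝ) : ℂ) := by push_cast; rfl
  have h1 : riemannXi (1 + s) = ((s * (2 * π ^ (-(1 + s) / 2) * Real.Gamma ((3 + s) / 2)) : ℝ) : ℂ) *
      riemannZeta (1 + s) := by
    have hne : (1 + s : ℝ) ≠ 0 := by positivity
    have e2 : Real.Gamma ((3 + s) / 2) = (1 + s) / 2 * Real.Gamma ((1 + s) / 2) := by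
      rw [← Real.Gamma_add_one (by positivity)]; congr 1; ring
    rw [e1, riemannXi_eq (by exact_mod_cast hne) (by norm_cast; linarith) hG0, hG, e2]
    push_cast
    ring
  have hp2 : 0 < 2 * π ^ (-(1 + s) / 2) * Real.Gamma ((3 + s) / 2) :=
    mul_pos (mul_pos two_pos (rpow_pos_of_pos pi_pos _)) (Real.Gamma_pos_of_pos (by positivity))
  rw [h1, norm_mul, Complex.norm_real, norm_of_nonneg (by positivity),
    log_mul (by positivity) (norm_ne_zero_iff.mpr hz), log_mul hs.ne' hp2.ne']
  ring

theorem tsum_inv_odd_sq_mul_le {x : ℝ} (hx : 1 ≤ x) :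
    Summable (fun n : ℕ => 1 / (2 * (n : ℝ) + 3) ^ 2) ∧
    Summable (fun n : ℕ => 1 / (2 * (n : ℝ) + 3) ^ 2 * x ^ (-(2 * (n : ℝ) + 3))) ∧
    ∑' n : ℕ, 1 / (2 * (n : ℝ) + 3) ^ 2 * x ^ (-(2 * (n : ℝ) + 3)) ≤ 1 / (3 * x ^ 3) := by
  have hx0 : 0 < x := by linarith
  have hF : ∀ N : ℕ, ∑ n ∈ Finset.range N, 1 / (2 * (n : ℝ) + 3) ^ 2 ≤ 1 / 4 - 1 / (4 * (N : ℝ) + 4) := by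
    intro N
    induction N with
    | zero => norm_num
    | succ n ih =>
      rw [Finset.sum_range_succ]
      have : 1 / (2 * (n : ℝ) + 3) ^ 2 ≤ 1 / (4 * n + 4) - 1 / (4 * (n + 1 : ℕ) + 4) := by
        push_cast
        rw [div_sub_div _ _ (by positivity) (by positivity), div_le_div_iff₀ (by positivity)
          (by positivity)]
        nlinarith
      linarith
  have hS : Summable (fun n : ℕ => 1 / (2 * (n : ℝ) + 3) ^ 2) := by
    refine summable_of_sum_range_le (c := 1 / 4) (fun n => by positivity) fun N => ?_
    have : 0 ≤ 1 / (4 * (N : ℝ) + 4) := by positivity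
    linarith [hF N]
  have hT : ∑' n : ℕ, 1 / (2 * (n : ℝ) + 3) ^ 2 ≤ 1 / 4 := by
    refine Real.tsum_le_of_sum_range_le (fun n => by positivity) fun N => ?_
    have : 0 ≤ 1 / (4 * (N : ℝ) + 4) := by positivity
    linarith [hF N]
  have hle : ∀ n : ℕ, 1 / (2 * (n : ℝ) + 3) ^ 2 * x ^ (-(2 * (n : ℝ) + 3)) ≤
      1 / (2 * (n : ℝ) + 3) ^ 2 * (1 / x ^ 3) := by
    intro n
    refine mul_le_mul_of_nonneg_left ?_ (by positivity)
    rw [← rpow_natCast, one_div, ← rpow_neg hx0.le]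
    refine rpow_le_rpow_of_exponent_le hx ?_
    push_cast
    linarith [(Nat.cast_nonneg n : (0 : ℝ) ≤ n)]
  have hS2 := Summable.of_nonneg_of_le (fun n => by positivity) hle (hS.mul_right (1 / x ^ 3))
  refine ⟨hS, hS2, (hS2.tsum_le_tsum hle (hS.mul_right _)).trans ?_⟩
  rw [tsum_mul_right]
  calc _ ≤ 1 / 3 * (1 / x ^ 3) := by gcongr; linarith
    _ = _ := by field_simp

theorem exists_hasSum_log_zeta
    (RH : ∀ s : ℂ, riemannZeta s = 0 → 0 < s.re → s.re < 1 → s.re = 1 / 2) {B : ℝ}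
    (hB : B = (1 / 2) * Real.log (4 * Real.pi) - 1 - Real.eulerMascheroniConstant / 2) :
    ∃ (J : Type) (_ : Countable J) (c : J → ℝ) (q : J → ℂ), (∀ j, 0 ≤ c j) ∧
      (∀ j, 1 / 2 ≤ (q j).re) ∧
      (∀ s : ℝ, 0 < s → HasSum (fun j => c j * (s * (1 / q j).re - log ‖1 + s / q j‖))
        (eulerMascheroniConstant * s - log s - log ‖riemannZeta (1 + s)‖)) ∧
      Summable (fun j => c j / ‖q j‖ ^ 2) ∧
      ∀ x : ℝ, 1 ≤ x → ∑' j, c j / ‖q j‖ ^ 2 * x ^ (-(q j).re) ≤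
        2 * |B| / √x + 1 / (3 * x ^ 3) := by
  obtain ⟨m, t, hm, ht, hsum⟩ := hasSum_log_norm_riemannXi RH
  have hq := hasSum_div_quarter_add hm ht hsum tendsto_log_norm_riemannXi_div
  have hBq : (eulerMascheroniConstant - log (4 * π)) / 2 + 1 = -B := by rw [hB]; ring
  rw [hBq] at hq
  have hB0 : 0 ≤ -B := hq.nonneg fun i => by have := hm i; have := ht i; positivity
  have habs : |B| = -B := abs_of_nonpos (by linarith)
  have hnq : ∀ i, ‖(⟨1 / 2, √(t i)⟩ : ℂ)‖ ^ 2 = 1 / 4 + t i := by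
    intro i
    rw [← Complex.normSq_eq_norm_sq, Complex.normSq_mk, mul_self_sqrt (ht i)]
    ring
  have hnn : ∀ n : ℕ, ‖(2 * n + 3 : ℂ)‖ = 2 * (n : ℝ) + 3 := by
    intro n
    have : (2 * n + 3 : ℂ) = ((2 * n + 3 : ℕ) : ℂ) := by push_cast; rfl
    rw [this, Complex.norm_natCast]
    push_cast
    rfl
  have hren : ∀ n : ℕ, (2 * n + 3 : ℂ).re = 2 * (n : ℝ) + 3 := by
    intro n; simp
  refine ⟨_ ⊕ ℕ, ?_, Sum.elim (fun i => 2 * m i) fun _ => 1,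
    Sum.elim (fun i => (⟨1 / 2, √(t i)⟩ : ℂ)) fun n : ℕ => (2 * n + 3 : ℂ), ?_, ?_, ?_, ?_, ?_⟩
  · have := countable_riemannXiSqrt_zeros
    infer_instance
  · rintro (i | n)
    · simpa using hm i
    · simp
  · rintro (i | n)
    · simp
    · simp only [Sum.elim_inr, hren]
      linarith [(Nat.cast_nonneg n : (0 : ℝ) ≤ n)]
  · intro s hs
    have hval : eulerMascheroniConstant * s - log s - log ‖riemannZeta (1 + s)‖ =
        (s * -B - log ‖riemannXi (1 + s)‖) +
        ((log (4 * π) / 2 - 1 + eulerMascheroniConstant / 2) * s +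
          log (2 * π ^ (-(1 + s) / 2) * Real.Gamma ((3 + s) / 2))) := by
      rw [log_norm_riemannZeta_one_add hs, hB]
      ring
    rw [hval]
    have hA : HasSum (fun i => 2 * m i * (s * (1 / (⟨1 / 2, √(t i)⟩ : ℂ)).re -
        log ‖1 + s / (⟨1 / 2, √(t i)⟩ : ℂ)‖)) (s * -B - log ‖riemannXi (1 + s)‖) := by
      refine ((hq.mul_left s).sub (hsum s hs.le)).congr_fun fun i => ?_
      have h0 : (0 : ℝ) < 1 / 4 + t i := by linarith [ht i]
      have hne : (⟨1 / 2, √(t i)⟩ : ℂ) ≠ 0 := by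
        intro h
        have := congrArg Complex.re h
        norm_num at this
      have e1 : (1 / (⟨1 / 2, √(t i)⟩ : ℂ)).re = (1 / 2) / (1 / 4 + t i) := by
        rw [one_div, Complex.inv_re, Complex.normSq_eq_norm_sq, hnq]
      have e2 : 2 * log ‖1 + s / (⟨1 / 2, √(t i)⟩ : ℂ)‖ =
          log (((s + 1 / 2) ^ 2 + t i) / (1 / 4 + t i)) := by
        have e3 : 1 + s / (⟨1 / 2, √(t i)⟩ : ℂ) =
            (⟨s + 1 / 2, √(t i)⟩ : ℂ) / (⟨1 / 2, √(t i)⟩ : ℂ) := by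
          rw [eq_div_iff hne, add_mul, div_mul_cancel₀ _ hne]
          apply Complex.ext <;> simp [add_comm]
        have e4 : ‖(⟨s + 1 / 2, √(t i)⟩ : ℂ)‖ ^ 2 = (s + 1 / 2) ^ 2 + t i := by
          rw [← Complex.normSq_eq_norm_sq, Complex.normSq_mk, mul_self_sqrt (ht i)]
          ring
        rw [e3, norm_div, ← hnq, ← e4, ← div_pow, log_pow]
        push_cast
        rfl
      rw [e1, mul_sub, mul_assoc 2 (m i) (log _), mul_left_comm 2 (m i) (log _), e2]
      field_simp
    have hC : HasSum (fun n : ℕ => (1 : ℝ) * (s * (1 / (2 * n + 3 : ℂ)).re -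
        log ‖1 + s / (2 * n + 3 : ℂ)‖)) ((log (4 * π) / 2 - 1 + eulerMascheroniConstant / 2) * s +
          log (2 * π ^ (-(1 + s) / 2) * Real.Gamma ((3 + s) / 2))) := by
      refine (hasSum_sub_log_one_add_div_odd hs.le).congr_fun fun n => ?_
      have e1 : (1 / (2 * n + 3 : ℂ)).re = 1 / (2 * (n : ℝ) + 3) := by
        rw [show (1 / (2 * n + 3 : ℂ)) = ((1 / (2 * (n : ℝ) + 3) : ℝ) : ℂ) by push_cast; rfl,
          Complex.ofReal_re]
      have e2 : ‖1 + s / (2 * n + 3 : ℂ)‖ = 1 + s / (2 * (n : ℝ) + 3) := by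
        rw [show (1 + s / (2 * n + 3 : ℂ)) = ((1 + s / (2 * (n : ℝ) + 3) : ℝ) : ℂ) by
          push_cast; rfl, Complex.norm_real, norm_of_nonneg (by positivity)]
      rw [e1, e2]
      ring
    exact HasSum.sum hA hC
  · refine Summable.sum _ ?_ ?_
    · refine (hq.summable.mul_left 2).congr fun i => ?_
      simp only [Function.comp, Sum.elim_inl, hnq]
      ring
    · refine (tsum_inv_odd_sq_mul_le le_rfl).1.congr fun n => ?_
      simp only [Function.comp, Sum.elim_inr, hnn]
  · intro x hx
    obtain ⟨-, h2, h3⟩ := tsum_inv_odd_sq_mul_le hx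
    have hx0 : 0 < x := by linarith
    have hA : HasSum (fun i => 2 * m i / ‖(⟨1 / 2, √(t i)⟩ : ℂ)‖ ^ 2 *
        x ^ (-(⟨1 / 2, √(t i)⟩ : ℂ).re)) (2 * |B| / √x) := by
      have := hq.mul_right (2 / √x)
      rw [habs]
      rw [show 2 * -B / √x = -B * (2 / √x) by ring]
      refine this.congr_fun fun i => ?_
      rw [hnq, sqrt_eq_rpow x, rpow_neg hx0.le]
      ring
    have hC : HasSum (fun n : ℕ => 1 / ‖(2 * n + 3 : ℂ)‖ ^ 2 * x ^ (-(2 * n + 3 : ℂ).re))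
        (∑' n : ℕ, 1 / (2 * (n : ℝ) + 3) ^ 2 * x ^ (-(2 * (n : ℝ) + 3))) := by
      refine h2.hasSum.congr_fun fun n => ?_
      rw [hnn, hren]
    rw [(HasSum.sum (f := fun j => Sum.elim (fun i => 2 * m i) (fun _ => 1) j /
      ‖Sum.elim (fun i => (⟨1 / 2, √(t i)⟩ : ℂ)) (fun n : ℕ => (2 * n + 3 : ℂ)) j‖ ^ 2 *
      x ^ (-(Sum.elim (fun i => (⟨1 / 2, √(t i)⟩ : ℂ)) (fun n : ℕ => (2 * n + 3 : ℂ)) j).re))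
      hA hC).tsum_eq]
    linarith

/-- The Laplace transform of `f` converges absolutely at `s`, with value `L`. -/
def HasLaplaceAt (f : ℝ → ℝ) (s L : ℝ) : Prop :=
  IntegrableOn (fun u => exp (-(s * u)) * f u) (Ioi 0) ∧
    ∫ u in Ioi 0, exp (-(s * u)) * f u = L

namespace HasLaplaceAt

variable {f g : ℝ → ℝ} {s L M : ℝ}

theorem congr (hf : HasLaplaceAt f s L) (h : ∀ u, 0 < u → g u = f u) (hL : L = M) :
    HasLaplaceAt g s M := by
  refine ⟨hf.1.congr_fun (fun u hu => ?_) measurableSet_Ioi, ?_⟩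
  · simp only [h u hu]
  · rw [← hL, ← hf.2]
    exact setIntegral_congr_fun measurableSet_Ioi fun u hu => by simp only [h u hu]

theorem add (hf : HasLaplaceAt f s L) (hg : HasLaplaceAt g s M) :
    HasLaplaceAt (fun u => f u + g u) s (L + M) := by
  refine ⟨(hf.1.add hg.1).congr_fun (fun u _ => ?_) measurableSet_Ioi, ?_⟩
  · simp [mul_add]
  · rw [← hf.2, ← hg.2, ← integral_add hf.1 hg.1]
    simp only [mul_add]

theorem const_mul (hf : HasLaplaceAt f s L) (c : ℝ) : HasLaplaceAt (fun u => c * f u) s (c * L) := by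
  refine ⟨?_, ?_⟩
  · unfold IntegrableOn
    simpa only [mul_left_comm c] using Integrable.const_mul hf.1 c
  · rw [← hf.2, ← integral_const_mul]
    simp only [mul_left_comm c]

theorem sub (hf : HasLaplaceAt f s L) (hg : HasLaplaceAt g s M) :
    HasLaplaceAt (fun u => f u - g u) s (L - M) :=
  (hf.add (hg.const_mul (-1))).congr (fun u _ => by ring) (by ring)

theorem comp_mul (hf : HasLaplaceAt f 1 L) (hs : 0 < s) :
    HasLaplaceAt (fun u => f (s * u)) s (L / s) := by
  have h1 := (integrableOn_Ioi_comp_mul_left_iff (fun u => exp (-(1 * u)) * f u) 0 hs).2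
    (by simpa using hf.1)
  have h2 := integral_comp_mul_left_Ioi (fun u => exp (-(1 * u)) * f u) 0 hs
  rw [mul_zero, hf.2] at h2
  simp only [one_mul] at h1 h2
  exact ⟨h1, h2.trans (by rw [smul_eq_mul]; ring)⟩

theorem one_sub_exp_mul (hf : HasLaplaceAt f s L) (hg : HasLaplaceAt f (s + 1) M) :
    HasLaplaceAt (fun u => (1 - exp (-u)) * f u) s (L - M) := by
  have h : ∀ u, exp (-(s * u)) * ((1 - exp (-u)) * f u) =
      exp (-(s * u)) * f u - exp (-((s + 1) * u)) * f u := by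
    intro u
    rw [show -((s + 1) * u) = -(s * u) + -u by ring, exp_add]
    ring
  refine ⟨(hf.1.sub hg.1).congr_fun (fun u _ => (h u).symm) measurableSet_Ioi, ?_⟩
  rw [← hf.2, ← hg.2, ← integral_sub hf.1 hg.1]
  simp only [h]

end HasLaplaceAt

theorem hasLaplaceAt_one {s : ℝ} (hs : 0 < s) : HasLaplaceAt (fun _ => 1) s (1 / s) := by
  have h1 := integrableOn_exp_mul_Ioi (neg_neg_of_pos hs) 0
  have h2 := integral_exp_mul_Ioi (neg_neg_of_pos hs) 0
  simp only [neg_mul] at h1 h2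
  refine ⟨by simpa using h1, ?_⟩
  simp only [mul_one, h2]
  simp

theorem hasLaplaceAt_rpow {a : ℝ} (ha : 0 < a) :
    HasLaplaceAt (fun u => u ^ (a - 1)) 1 (Real.Gamma a) := by
  have h1 := Real.GammaIntegral_convergent ha
  have h2 := Real.Gamma_eq_integral ha
  exact ⟨by simpa using h1, by simpa using h2.symm⟩

theorem hasLaplaceAt_id {s : ℝ} (hs : 0 < s) : HasLaplaceAt (fun u => u) s (1 / s ^ 2) := by
  have h := ((hasLaplaceAt_rpow (a := 2) two_pos).comp_mul hs).const_mul (1 / s)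
  refine h.congr (fun u _ => ?_) ?_
  · norm_num
    field_simp
  · rw [Real.Gamma_two]
    field_simp

theorem abs_mul_log_le {u : ℝ} (hu : 0 < u) : |u * log u| ≤ u ^ 2 + 1 := by
  have h1 := log_le_sub_one_of_pos hu
  have h2 := one_sub_inv_le_log_of_pos hu
  have h3 : u * (1 - u⁻¹) = u - 1 := by field_simp
  rw [abs_le]
  constructor <;> nlinarith

theorem hasLaplaceAt_mul_log_one :
    HasLaplaceAt (fun u => u * log u) 1 (1 - eulerMascheroniConstant) := by
  constructor
  · have h := ((hasLaplaceAt_rpow (a := 3) (by norm_num)).add (hasLaplaceAt_one one_pos)).1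
    refine h.mono' ?_ ?_
    · exact (by fun_prop : Measurable _).aestronglyMeasurable
    · refine (ae_restrict_iff' measurableSet_Ioi).2 (ae_of_all _ fun u hu => ?_)
      rw [norm_mul, norm_of_nonneg (exp_pos _).le]
      have := abs_mul_log_le (show 0 < u from hu)
      norm_num
      gcongr
      simpa [abs_mul] using this
  · have h1 := Complex.hasDerivAt_GammaIntegral (s := 2) (by norm_num)
    have h2 : HasDerivAt Complex.GammaIntegral ((1 - eulerMascheroniConstant : ℝ) : ℂ) 2 := by
      have h3 := Complex.hasDerivAt_Gamma_nat 1
      have h4 : (Complex.GammaIntegral) =ᶠ[𝓝 2] Complex.Gamma := by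
        have : IsOpen {z : ℂ | 0 < z.re} := isOpen_lt continuous_const Complex.continuous_re
        filter_upwards [this.mem_nhds (show (2 : ℂ) ∈ {z : ℂ | 0 < z.re} by norm_num)] with z hz
        exact (Complex.Gamma_eq_integral hz).symm
      norm_num at h3
      refine (h3.congr_of_eventuallyEq h4).congr_deriv ?_
      push_cast
      ring
    have h5 := h1.unique h2
    rw [← Complex.ofReal_inj, ← h5, ← integral_complex_ofReal]
    refine setIntegral_congr_fun measurableSet_Ioi fun u _ => ?_
    simp only
    rw [show (2 : ℂ) - 1 = 1 by norm_num, Complex.cpow_one]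
    push_cast
    ring_nf

theorem hasLaplaceAt_mul_log {s : ℝ} (hs : 0 < s) :
    HasLaplaceAt (fun u => u * log u) s ((1 - eulerMascheroniConstant - log s) / s ^ 2) := by
  refine ((hasLaplaceAt_mul_log_one.comp_mul hs).const_mul (1 / s)).sub
    ((hasLaplaceAt_id hs).const_mul (log s)) |>.congr (fun u hu => ?_) ?_
  · rw [log_mul hs.ne' hu.ne']
    field_simp
    ring
  · field_simp

theorem norm_vonMangoldt_div_log_le (n : ℕ) :
    ‖((ArithmeticFunction.vonMangoldt n / log n : ℝ) : ℂ)‖ ≤ 1 := by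
  have h0 : (0 : ℝ) ≤ log n := log_natCast_nonneg n
  rw [Complex.norm_real, norm_of_nonneg (div_nonneg ArithmeticFunction.vonMangoldt_nonneg h0)]
  exact div_le_one_of_le₀ ArithmeticFunction.vonMangoldt_le_log h0

theorem exp_LSeries_vonMangoldt_div_log {s : ℝ} (hs : 1 < s) :
    Complex.exp (LSeries (fun n => ((ArithmeticFunction.vonMangoldt n / log n : ℝ) : ℂ)) s) =
      riemannZeta s := by
  set f : ℕ → ℂ := fun n => ((ArithmeticFunction.vonMangoldt n / log n : ℝ) : ℂ) with hf
  have habs : LSeries.abscissaOfAbsConv f ≤ 1 :=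
    LSeries.abscissaOfAbsConv_le_of_le_const ⟨1, fun n _ => norm_vonMangoldt_div_log_le n⟩
  have hder : ∀ z : ℂ, 1 < z.re → HasDerivAt (LSeries f) (deriv riemannZeta z / riemannZeta z) z := by
    intro z hz
    have h1 := LSeries_hasDerivAt (f := f) (s := z)
      (habs.trans_lt (by exact_mod_cast hz))
    refine h1.congr_deriv ?_
    have h2 := ArithmeticFunction.LSeries_vonMangoldt_eq_deriv_riemannZeta_div hz
    rw [neg_eq_iff_eq_neg, ← neg_div, ← h2]
    refine LSeries_congr (fun {n} hn => ?_) z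
    rcases eq_or_ne n 1 with rfl | hn1
    · simp [LSeries.logMul]
    · have : log n ≠ 0 := by
        have : (1 : ℝ) < n := by exact_mod_cast (by omega : 1 < n)
        exact (log_pos this).ne'
      simp only [LSeries.logMul, hf, ← Complex.natCast_log]
      rw [← Complex.ofReal_mul, mul_div_cancel₀ _ this]
  have hopen : IsOpen {z : ℂ | 1 < z.re} := isOpen_lt continuous_const Complex.continuous_re
  have hH : ∀ z : ℂ, 1 < z.re →
      HasDerivAt (fun z => riemannZeta z * Complex.exp (-LSeries f z)) 0 z := by
    intro z hz
    have hz1 : z ≠ 1 := by rintro rfl; simp at hz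
    refine ((differentiableAt_riemannZeta hz1).hasDerivAt.mul (hder z hz).neg.cexp).congr_deriv ?_
    have := riemannZeta_ne_zero_of_one_lt_re hz
    field_simp
    ring
  obtain ⟨a, ha⟩ := hopen.exists_is_const_of_deriv_eq_zero
    (convex_halfSpace_re_gt 1).isPreconnected
    (fun z hz => (hH z hz).differentiableAt.differentiableWithinAt) (fun z hz => (hH z hz).deriv)
  have hlim : Tendsto (fun x : ℝ => riemannZeta x * Complex.exp (-LSeries f x)) atTop (𝓝 1) := by
    have h1 : Tendsto (fun x : ℝ => riemannZeta x) atTop (𝓝 1) := by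
      have := LSeries.tendsto_atTop (f := 1)
        (by rw [LSeries.abscissaOfAbsConv_one]; exact EReal.coe_lt_top 1)
      refine this.congr' ?_
      filter_upwards [eventually_gt_atTop 1] with x hx
      exact LSeries_one_eq_riemannZeta (by simpa using hx)
    have h2 := LSeries.tendsto_atTop (f := f) (habs.trans_lt (EReal.coe_lt_top 1))
    have h3 : f 1 = 0 := by simp [hf]
    rw [h3] at h2
    simpa using h1.mul (Complex.continuous_exp.continuousAt.tendsto.comp h2.neg)
  have ha1 : a = 1 := by
    refine tendsto_nhds_unique (tendsto_const_nhds.congr' ?_) hlim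
    filter_upwards [eventually_gt_atTop 1] with x hx
    exact (ha x (by simpa using hx)).symm
  have := ha s (by simpa using hs)
  rw [ha1, Complex.exp_neg, ← div_eq_mul_inv, div_eq_one_iff_eq (Complex.exp_ne_zero _)] at this
  exact this.symm

theorem hasSum_log_norm_riemannZeta {s : ℝ} (hs : 0 < s) :
    HasSum (fun n : ℕ => ArithmeticFunction.vonMangoldt n / (n * log n) * exp (-(s * log n)))
      (log ‖riemannZeta (1 + s)‖) := by
  have h1 : (1 : ℝ) < 1 + s := by linarith
  have h2 := exp_LSeries_vonMangoldt_div_log h1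
  have h3 := LSeriesSummable_of_bounded_of_one_lt_real
    (f := fun n => ((ArithmeticFunction.vonMangoldt n / log n : ℝ) : ℂ)) (m := 1)
    (fun n _ => norm_vonMangoldt_div_log_le n) h1
  have h4 := Complex.hasSum_re h3.LSeriesHasSum
  rw [show (1 + s : ℂ) = ((1 + s : ℝ) : ℂ) by push_cast; rfl, ← h2, Complex.norm_exp, log_exp]
  refine h4.congr_fun fun n => ?_
  rcases eq_or_ne n 0 with rfl | hn
  · simp
  · have hn0 : (0 : ℝ) < n := by exact_mod_cast Nat.pos_of_ne_zero hn
    rw [LSeries.term_of_ne_zero hn, ← Complex.ofReal_natCast, ← Complex.ofReal_cpow hn0.le,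
      ← Complex.ofReal_div, Complex.ofReal_re, rpow_add hn0, rpow_one, exp_neg, mul_comm s,
      ← rpow_def_of_pos hn0]
    field_simp

section ExpBound

variable {ι : Type*} {f : ι → ℝ → ℝ} {b : ι → ℝ} {a : ℝ}

theorem summable_of_abs_le_mul_exp (hb : Summable b)
    (h : ∀ i u, 0 ≤ u → |f i u| ≤ b i * exp (a * u)) {u : ℝ} (hu : 0 ≤ u) :
    Summable (fun i => f i u) :=
  Summable.of_norm_bounded (hb.mul_right (exp (a * u))) fun i => h i u hu

theorem abs_tsum_le_mul_exp (hb : Summable b)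
    (h : ∀ i u, 0 ≤ u → |f i u| ≤ b i * exp (a * u)) {u : ℝ} (hu : 0 ≤ u) :
    |∑' i, f i u| ≤ (∑' i, b i) * exp (a * u) := by
  rw [← tsum_mul_right]
  exact tsum_of_norm_bounded (f := fun i => f i u) (hb.mul_right (exp (a * u))).hasSum
    fun i => h i u hu

theorem continuousOn_tsum_of_abs_le_mul_exp (hf : ∀ i, ContinuousOn (f i) (Ici 0)) (hb : Summable b)
    (h : ∀ i u, 0 ≤ u → |f i u| ≤ b i * exp (a * u)) :
    ContinuousOn (fun u => ∑' i, f i u) (Ici 0) := by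
  have h1 : ContinuousOn (fun u => ∑' i, exp (-(a * u)) * f i u) (Ici 0) := by
    refine continuousOn_tsum (fun i => ContinuousOn.mul (by fun_prop) (hf i)) hb fun i u hu => ?_
    rw [norm_mul, norm_of_nonneg (exp_pos _).le, exp_neg, inv_mul_le_iff₀ (exp_pos _), mul_comm]
    exact h i u hu
  refine (ContinuousOn.mul (f := fun u => exp (a * u)) (by fun_prop) h1).congr fun u _ => ?_
  simp only [tsum_mul_left, Pi.mul_apply]
  rw [← mul_assoc, ← exp_add]
  simp

theorem hasLaplaceAt_exp_mul {s : ℝ} (ha : a < s) :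
    HasLaplaceAt (fun u => exp (a * u)) s (1 / (s - a)) := by
  have h := hasLaplaceAt_one (sub_pos.2 ha)
  have e : ∀ u, exp (-((s - a) * u)) * 1 = exp (-(s * u)) * exp (a * u) := by
    intro u
    rw [← exp_add, mul_one]
    ring_nf
  obtain ⟨h1, h2⟩ := h
  simp only [e] at h1 h2
  exact ⟨h1, h2⟩

theorem hasLaplaceAt_tsum [Countable ι] {s : ℝ} {L : ι → ℝ} (ha : a < s)
    (hf : ∀ i, ContinuousOn (f i) (Ici 0)) (hL : ∀ i, HasLaplaceAt (f i) s (L i)) (hb : Summable b)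
    (h : ∀ i u, 0 ≤ u → |f i u| ≤ b i * exp (a * u)) {M : ℝ} (hM : HasSum L M) :
    HasLaplaceAt (fun u => ∑' i, f i u) s M := by
  have hg := (hasLaplaceAt_exp_mul ha).const_mul (∑' i, b i)
  have hI : IntegrableOn (fun u => exp (-(s * u)) * ∑' i, f i u) (Ioi 0) := by
    refine hg.1.mono' ?_ ?_
    · refine ContinuousOn.aestronglyMeasurable ?_ measurableSet_Ioi
      exact ContinuousOn.mul (by fun_prop)
        ((continuousOn_tsum_of_abs_le_mul_exp hf hb h).mono Ioi_subset_Ici_self)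
    · refine (ae_restrict_iff' measurableSet_Ioi).2 (ae_of_all _ fun u hu => ?_)
      rw [norm_mul, norm_of_nonneg (exp_pos _).le]
      exact mul_le_mul_of_nonneg_left (abs_tsum_le_mul_exp hb h (le_of_lt hu)) (exp_pos _).le
  refine ⟨hI, ?_⟩
  have hs := hasSum_integral_of_dominated_convergence (μ := volume.restrict (Ioi (0 : ℝ)))
    (F := fun i u => exp (-(s * u)) * f i u) (f := fun u => exp (-(s * u)) * ∑' i, f i u)
    (fun i u => b i * (exp (-(s * u)) * exp (a * u))) (fun i => (hL i).1.1) ?_ ?_ ?_ ?_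
  · simp only [fun i => (hL i).2] at hs
    exact hs.unique hM
  · intro i
    refine (ae_restrict_iff' measurableSet_Ioi).2 (ae_of_all _ fun u hu => ?_)
    rw [norm_mul, norm_of_nonneg (exp_pos _).le, mul_left_comm]
    exact mul_le_mul_of_nonneg_left (h i u (le_of_lt hu)) (exp_pos _).le
  · exact ae_of_all _ fun u => hb.mul_right _
  · simp only [tsum_mul_right]
    exact Integrable.const_mul (hasLaplaceAt_exp_mul ha).1 _
  · refine (ae_restrict_iff' measurableSet_Ioi).2 (ae_of_all _ fun u hu => ?_)
    exact (summable_of_abs_le_mul_exp hb h (le_of_lt hu)).hasSum.mul_left _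

end ExpBound

theorem hasLaplaceAt_max_sub {a s : ℝ} (ha : 0 ≤ a) (hs : 0 < s) :
    HasLaplaceAt (fun u => max (u - a) 0) s (exp (-(s * a)) / s ^ 2) := by
  have h := hasLaplaceAt_id hs
  set F : ℝ → ℝ := (Ioi 0).indicator fun u => exp (-(s * u)) * u with hF
  have hFi : Integrable F := (integrable_indicator_iff measurableSet_Ioi).2 h.1
  have hFv : ∫ u, F u = 1 / s ^ 2 := by rw [hF, integral_indicator measurableSet_Ioi, h.2]
  have e : ∀ u, (Ioi 0).indicator (fun u => exp (-(s * u)) * max (u - a) 0) u =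
      exp (-(s * a)) * F (u - a) := by
    intro u
    by_cases hu : a < u
    · have h0 : u ∈ Ioi 0 := lt_of_le_of_lt ha hu
      have h1 : u - a ∈ Ioi 0 := sub_pos.2 hu
      rw [hF, indicator_of_mem h0, indicator_of_mem h1, max_eq_left (le_of_lt h1), ← mul_assoc,
        ← exp_add]
      ring_nf
    · have h1 : u - a ∉ Ioi 0 := fun h => hu (sub_pos.1 h)
      rw [hF, indicator_of_notMem h1, mul_zero]
      by_cases h0 : u ∈ Ioi 0
      · rw [indicator_of_mem h0, max_eq_right (by linarith), mul_zero]
      · rw [indicator_of_notMem h0]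
  constructor
  · rw [← integrable_indicator_iff measurableSet_Ioi]
    exact ((hFi.comp_sub_right a).const_mul _).congr (ae_of_all _ fun u => (e u).symm)
  · rw [← integral_indicator measurableSet_Ioi, integral_congr_ae (ae_of_all _ e),
      integral_const_mul, integral_sub_right_eq_self F a, hFv]
    ring

theorem abs_vonMangoldt_mul_max_le (n : ℕ) (u : ℝ) :
    |ArithmeticFunction.vonMangoldt n / (n * log n) * max (u - log n) 0| ≤
      2 * (n : ℝ) ^ (-(3 / 2) : ℝ) * exp (1 / 2 * u) := by
  rcases eq_or_ne n 0 with rfl | hn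
  · simp only [ArithmeticFunction.map_zero, zero_div, zero_mul, abs_zero]
    positivity
  have hn0 : (0 : ℝ) < n := by exact_mod_cast Nat.pos_of_ne_zero hn
  have hc0 : 0 ≤ ArithmeticFunction.vonMangoldt n / (n * log n) :=
    div_nonneg ArithmeticFunction.vonMangoldt_nonneg (mul_nonneg hn0.le (log_natCast_nonneg n))
  have hc : ArithmeticFunction.vonMangoldt n / (n * log n) ≤ (n : ℝ)⁻¹ := by
    rw [mul_comm, ← div_div, div_le_iff₀ hn0, inv_mul_cancel₀ hn0.ne']
    exact div_le_one_of_le₀ ArithmeticFunction.vonMangoldt_le_log (log_natCast_nonneg n)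
  have hm : max (u - log n) 0 ≤ 2 * exp ((u - log n) / 2) := by
    refine max_le ?_ (by positivity)
    linarith [add_one_le_exp ((u - log n) / 2)]
  rw [abs_of_nonneg (mul_nonneg hc0 (le_max_right _ _))]
  calc _ ≤ (n : ℝ)⁻¹ * (2 * exp ((u - log n) / 2)) :=
        mul_le_mul hc hm (le_max_right _ _) (by positivity)
    _ = _ := by
      rw [rpow_def_of_pos hn0, mul_assoc, ← exp_add, mul_left_comm]
      nth_rw 1 [← exp_log hn0]
      rw [← exp_neg, ← exp_add]
      ring_nf

theorem summable_two_mul_rpow : Summable (fun n : ℕ => 2 * (n : ℝ) ^ (-(3 / 2) : ℝ)) :=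
  (summable_nat_rpow.2 (by norm_num)).mul_left 2

theorem hasLaplaceAt_tsum_vonMangoldt {s : ℝ} (hs : 1 ≤ s) :
    HasLaplaceAt (fun u => ∑' n : ℕ, ArithmeticFunction.vonMangoldt n / (n * log n) *
      max (u - log n) 0) s (log ‖riemannZeta (1 + s)‖ / s ^ 2) := by
  have hs0 : 0 < s := by linarith
  refine hasLaplaceAt_tsum (a := 1 / 2) (by linarith) (fun n => by fun_prop)
    (fun n => (hasLaplaceAt_max_sub (log_natCast_nonneg n) hs0).const_mul _) summable_two_mul_rpow
    (fun n u _ => abs_vonMangoldt_mul_max_le n u) ?_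
  refine ((hasSum_log_norm_riemannZeta hs0).div_const (s ^ 2)).congr_fun fun n => ?_
  ring

/-- The contribution of a zero `-q` to the explicit formula, as a function of `u = log x`. -/
noncomputable def zeroTerm (q : ℂ) (u : ℝ) : ℂ :=
  ∫ τ : ℝ in Ioi 0, Complex.exp (-((q + τ) * u)) / (q + τ) ^ 2

section ZeroTerm

variable {q : ℂ}

theorem normSq_add_sq_le_normSq_add (hq : 1 / 2 ≤ q.re) {τ : ℝ} (hτ : 0 ≤ τ) :
    ‖q‖ ^ 2 + τ ^ 2 ≤ ‖q + τ‖ ^ 2 := by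
  rw [← Complex.normSq_eq_norm_sq, ← Complex.normSq_eq_norm_sq, Complex.normSq_apply,
    Complex.normSq_apply]
  simp only [Complex.add_re, Complex.ofReal_re, Complex.add_im, Complex.ofReal_im, add_zero]
  nlinarith

theorem quarter_le_norm_sq (hq : 1 / 2 ≤ q.re) : 1 / 4 ≤ ‖q‖ ^ 2 := by
  rw [← Complex.normSq_eq_norm_sq, Complex.normSq_apply]
  nlinarith [mul_self_nonneg q.im]

theorem add_ofReal_ne_zero (hq : 1 / 2 ≤ q.re) {τ : ℝ} (hτ : 0 ≤ τ) : q + τ ≠ 0 := by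
  intro h
  have := congrArg Complex.re h
  simp at this
  linarith

theorem norm_exp_div_sq (q : ℂ) (τ u : ℝ) :
    ‖Complex.exp (-((q + τ) * u)) / (q + τ) ^ 2‖ = exp (-((q.re + τ) * u)) / ‖q + τ‖ ^ 2 := by
  rw [norm_div, norm_pow, Complex.norm_exp]
  simp

theorem norm_exp_div_sq_le (hq : 1 / 2 ≤ q.re) {τ u : ℝ} (hτ : 0 ≤ τ) (hu : 0 ≤ u) :
    ‖Complex.exp (-((q + τ) * u)) / (q + τ) ^ 2‖ ≤ 4 * (1 + τ ^ 2)⁻¹ := by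
  rw [norm_exp_div_sq, ← div_eq_mul_inv]
  have h1 := normSq_add_sq_le_normSq_add hq hτ
  have h2 := quarter_le_norm_sq hq
  have h3 : exp (-((q.re + τ) * u)) ≤ 1 := by
    rw [exp_le_one_iff, neg_nonpos]
    exact mul_nonneg (by linarith) hu
  rw [div_le_div_iff₀ (by nlinarith) (by positivity)]
  nlinarith [exp_pos (-((q.re + τ) * u)), sq_nonneg τ]

theorem measurable_exp_div_sq (q : ℂ) :
    Measurable (fun p : ℝ × ℝ => Complex.exp (-((q + p.2) * p.1)) / (q + p.2) ^ 2) := by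
  fun_prop

theorem norm_zeroTerm_le (hq : 1 / 2 ≤ q.re) {u : ℝ} (hu : 0 < u) :
    ‖zeroTerm q u‖ ≤ exp (-(q.re * u)) / (‖q‖ ^ 2 * u) := by
  obtain ⟨h1, h2⟩ := hasLaplaceAt_one hu
  have h := norm_integral_le_of_norm_le
    (f := fun τ : ℝ => Complex.exp (-((q + τ) * u)) / (q + τ) ^ 2)
    (Integrable.const_mul h1 (exp (-(q.re * u)) / ‖q‖ ^ 2)) ?_
  · refine h.trans_eq ?_
    rw [integral_const_mul, h2]
    field_simp
  · refine (ae_restrict_iff' measurableSet_Ioi).2 (ae_of_all _ fun τ hτ => ?_)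
    have h3 := normSq_add_sq_le_normSq_add hq (le_of_lt hτ)
    have h4 := quarter_le_norm_sq hq
    rw [norm_exp_div_sq, mul_one, div_mul_eq_mul_div, ← exp_add]
    rw [show -((q.re + τ) * u) = -(q.re * u) + -(u * τ) by ring]
    have h5 : ‖q‖ ^ 2 ≤ ‖q + τ‖ ^ 2 := by nlinarith [sq_nonneg τ]
    exact div_le_div_of_nonneg_left (exp_pos _).le (by linarith) h5

theorem continuousOn_zeroTerm (hq : 1 / 2 ≤ q.re) : ContinuousOn (zeroTerm q) (Ici 0) := by
  refine continuousOn_of_dominated (bound := fun τ => 4 * (1 + τ ^ 2)⁻¹) (fun u _ => ?_)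
    (fun u hu => ?_) (integrable_inv_one_add_sq.const_mul 4).integrableOn
    (ae_of_all _ fun τ => by fun_prop)
  · exact ((measurable_exp_div_sq q).comp (measurable_prodMk_left (x := u))).aestronglyMeasurable
  · exact (ae_restrict_iff' measurableSet_Ioi).2 (ae_of_all _ fun τ hτ =>
      norm_exp_div_sq_le hq (le_of_lt hτ) hu)

theorem integral_inv_sq_mul_add (hq : 1 / 2 ≤ q.re) {s : ℝ} (hs : 0 < s)
    (hi : IntegrableOn (fun τ : ℝ => 1 / ((q + τ) ^ 2 * (q + τ + s))) (Ioi 0)) :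
    ∫ τ : ℝ in Ioi 0, 1 / ((q + τ) ^ 2 * (q + τ + s)) =
      (s * (1 / q) - Complex.log (1 + s / q)) / s ^ 2 := by
  have hsc : (s : ℂ) ≠ 0 := by exact_mod_cast hs.ne'
  have hd : ∀ τ ∈ Ici (0 : ℝ), HasDerivAt (fun τ : ℝ =>
      -(s * (1 / (q + τ)) - Complex.log (1 + s / (q + τ))) / s ^ 2)
      (1 / ((q + τ) ^ 2 * (q + τ + s))) τ := by
    intro τ hτ
    have hz := add_ofReal_ne_zero hq hτ
    have hre : 0 < (q + τ).re := by
      simp only [Complex.add_re, Complex.ofReal_re]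
      linarith [show (0 : ℝ) ≤ τ from hτ]
    have hzs : q + τ + s ≠ 0 := by
      intro h
      have := congrArg Complex.re h
      simp only [Complex.add_re, Complex.ofReal_re, Complex.zero_re] at this hre
      linarith
    have hsl : 1 + s / (q + τ) ∈ Complex.slitPlane := by
      left
      have h5 : 0 < Complex.normSq (q + τ) := Complex.normSq_pos.2 hz
      rw [Complex.add_re, Complex.one_re, Complex.div_re, Complex.ofReal_re, Complex.ofReal_im,
        zero_mul, zero_div, add_zero]
      positivity
    have h1 : HasDerivAt (fun z : ℂ => -(s * (1 / z) - Complex.log (1 + s / z)) / s ^ 2)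
        (1 / ((q + τ) ^ 2 * (q + τ + s))) (q + τ) := by
      have h2 : HasDerivAt (fun z : ℂ => 1 / z) (-1 / (q + τ) ^ 2) (q + τ) := by
        simpa [neg_div] using hasDerivAt_inv hz
      have h3 : HasDerivAt (fun z : ℂ => 1 + s / z) (s * (-1 / (q + τ) ^ 2)) (q + τ) := by
        simpa [div_eq_mul_inv] using (h2.const_mul (s : ℂ)).const_add 1
      refine (((h2.const_mul (s : ℂ)).sub (h3.clog hsl)).neg.div_const _).congr_deriv ?_
      have : 1 + s / (q + τ) = (q + τ + s) / (q + τ) := by field_simp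
      rw [this]
      field_simp
      ring
    have h4 : HasDerivAt (fun τ : ℝ => q + (τ : ℂ)) 1 τ :=
      (Complex.ofRealCLM.hasDerivAt (x := τ)).const_add q
    simpa [Function.comp_def] using h1.comp τ h4
  have hl : Tendsto (fun τ : ℝ => -(s * (1 / (q + τ)) - Complex.log (1 + s / (q + τ))) / s ^ 2)
      atTop (𝓝 0) := by
    have h0 : Tendsto (fun τ : ℝ => 1 / (q + τ)) atTop (𝓝 0) := by
      have : Tendsto (fun τ : ℝ => q + (τ : ℂ)) atTop (Bornology.cobounded ℂ) := by
        exact (tendsto_const_add_cobounded q).comp (RCLike.tendsto_ofReal_atTop_cobounded ℂ)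
      simpa [Function.comp_def] using tendsto_inv₀_cobounded.comp this
    have h1 : Tendsto (fun τ : ℝ => Complex.log (1 + s / (q + τ))) atTop (𝓝 0) := by
      have h2 : Tendsto (fun τ : ℝ => 1 + s / (q + τ)) atTop (𝓝 1) := by
        simpa [div_eq_mul_inv] using (h0.const_mul (s : ℂ)).const_add 1
      have h3 := (continuousAt_clog (x := 1) (by simp)).tendsto.comp h2
      simpa [Function.comp_def] using h3
    simpa using ((h0.const_mul (s : ℂ)).sub h1).neg.div_const ((s : ℂ) ^ 2)
  rw [integral_Ioi_of_hasDerivAt_of_tendsto' hd hi hl]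
  simp
  ring

theorem hasLaplaceAt_re_zeroTerm (hq : 1 / 2 ≤ q.re) {s : ℝ} (hs : 0 < s) :
    HasLaplaceAt (fun u => (zeroTerm q u).re) s
      ((s * (1 / q).re - log ‖1 + s / q‖) / s ^ 2) := by
  set F : ℝ → ℝ → ℂ := fun u τ => exp (-(s * u)) * (Complex.exp (-((q + τ) * u)) / (q + τ) ^ 2)
    with hF
  have hFi : Integrable (Function.uncurry F)
      ((volume.restrict (Ioi 0)).prod (volume.restrict (Ioi 0))) := by
    have hb := (hasLaplaceAt_one hs).1.mul_prod
      (integrable_inv_one_add_sq.const_mul 4).integrableOn (ν := volume.restrict (Ioi 0))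
    refine hb.mono' ?_ ?_
    · refine Measurable.aestronglyMeasurable ?_
      simp only [hF, Function.uncurry_def]
      exact Measurable.mul (by fun_prop) (measurable_exp_div_sq q)
    · rw [Measure.prod_restrict]
      refine (ae_restrict_iff' (measurableSet_Ioi.prod measurableSet_Ioi)).2
        (ae_of_all _ fun p hp => ?_)
      simp only [hF, Function.uncurry_def]
      rw [norm_mul, Complex.norm_real, norm_of_nonneg (exp_pos _).le, mul_one]
      exact mul_le_mul_of_nonneg_left
        (norm_exp_div_sq_le hq (le_of_lt hp.2) (le_of_lt hp.1)) (exp_pos _).le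
  have h1 : ∀ u, ∫ τ in Ioi 0, F u τ = exp (-(s * u)) * zeroTerm q u := by
    intro u
    rw [hF, integral_const_mul]
    rfl
  have h2 : ∀ τ ∈ Ioi (0 : ℝ), ∫ u in Ioi 0, F u τ = 1 / ((q + τ) ^ 2 * (q + τ + s)) := by
    intro τ hτ
    have hre : (-(q + τ + s)).re < 0 := by
      simp only [Complex.neg_re, Complex.add_re, Complex.ofReal_re]
      linarith [show (0 : ℝ) < τ from hτ]
    have e : ∀ u : ℝ, F u τ = Complex.exp (-(q + τ + s) * u) * (1 / (q + τ) ^ 2) := by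
      intro u
      simp only [hF]
      rw [Complex.ofReal_exp, ← mul_div_assoc, ← Complex.exp_add, div_eq_mul_one_div]
      push_cast
      ring_nf
    simp only [e]
    rw [integral_mul_const, integral_exp_mul_complex_Ioi hre]
    rw [← neg_div_neg_eq, neg_neg, neg_neg]
    simp
  have hI := hFi.integral_prod_left
  have hI2 := hFi.integral_prod_right
  have hswap := integral_integral_swap hFi
  simp only [Function.uncurry_apply_pair] at hI hI2
  rw [setIntegral_congr_fun measurableSet_Ioi h2, integral_inv_sq_mul_add hq hs
    (IntegrableOn.congr_fun hI2 h2 measurableSet_Ioi)] at hswap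
  have h3 : ∀ u, exp (-(s * u)) * (zeroTerm q u).re = (∫ τ in Ioi 0, F u τ).re := by
    intro u
    rw [h1, Complex.re_ofReal_mul]
  constructor
  · simp only [h3]
    exact hI.re
  · simp only [h3]
    have := integral_re hI
    simp only [RCLike.re_eq_complex_re] at this
    rw [this, hswap, ← Complex.ofReal_pow, Complex.div_ofReal_re, Complex.sub_re,
      Complex.re_ofReal_mul, Complex.log_re]

theorem abs_one_sub_exp_mul_re_zeroTerm_le (hq : 1 / 2 ≤ q.re) {u : ℝ} (hu : 0 ≤ u) :
    |(1 - exp (-u)) * (zeroTerm q u).re| ≤ 1 / ‖q‖ ^ 2 * exp (-(1 / 2) * u) := by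
  rcases hu.eq_or_lt with rfl | hu
  · simp
  have h1 : 0 ≤ 1 - exp (-u) := by
    rw [sub_nonneg, exp_le_one_iff]; linarith
  have h2 : 1 - exp (-u) ≤ u := by linarith [add_one_le_exp (-u)]
  rw [abs_mul, abs_of_nonneg h1]
  have h4 := quarter_le_norm_sq hq
  calc _ ≤ u * (exp (-(q.re * u)) / (‖q‖ ^ 2 * u)) :=
        mul_le_mul h2 ((Complex.abs_re_le_norm _).trans (norm_zeroTerm_le hq hu)) (abs_nonneg _)
          hu.le
    _ = 1 / ‖q‖ ^ 2 * exp (-(q.re * u)) := by field_simp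
    _ ≤ _ := by
      gcongr
      nlinarith

end ZeroTerm

theorem tendsto_exp_neg_mul_mul_log : Tendsto (fun u : ℝ => exp (-u) * (u * log u)) atTop (𝓝 0) := by
  have h1 := (tendsto_pow_mul_exp_neg_atTop_nhds_zero 2).add
    (tendsto_pow_mul_exp_neg_atTop_nhds_zero 0)
  rw [add_zero] at h1
  refine squeeze_zero_norm' ?_ h1
  filter_upwards [eventually_gt_atTop 0] with u hu
  rw [norm_mul, norm_of_nonneg (exp_pos _).le, pow_zero, ← add_mul, mul_comm]
  exact mul_le_mul_of_nonneg_right (abs_mul_log_le hu) (exp_pos _).le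

theorem tendsto_exp_neg_mul_of_abs_le {g : ℝ → ℝ} {K a : ℝ} (ha : a < 1)
    (h : ∀ u, 0 ≤ u → |g u| ≤ K * exp (a * u)) :
    Tendsto (fun u => exp (-u) * g u) atTop (𝓝 0) := by
  have h1 : Tendsto (fun u => K * exp (-((1 - a) * u))) atTop (𝓝 0) := by
    have := (tendsto_exp_neg_atTop_nhds_zero.comp
      (tendsto_id.const_mul_atTop (sub_pos.2 ha))).const_mul K
    simpa [Function.comp_def] using this
  refine squeeze_zero_norm' ?_ h1
  filter_upwards [eventually_ge_atTop 0] with u hu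
  rw [norm_mul, norm_of_nonneg (exp_pos _).le]
  calc _ ≤ exp (-u) * (K * exp (a * u)) := mul_le_mul_of_nonneg_left (h u hu) (exp_pos _).le
    _ = _ := by
      rw [mul_left_comm, ← exp_add]
      ring_nf

theorem tsum_vonMangoldt_explicit {J : Type*} [Countable J] {c : J → ℝ} {q : J → ℂ}
    (hc : ∀ j, 0 ≤ c j) (hq : ∀ j, 1 / 2 ≤ (q j).re)
    (hS : ∀ s : ℝ, 0 < s → HasSum (fun j => c j * (s * (1 / q j).re - log ‖1 + s / q j‖))
        (eulerMascheroniConstant * s - log s - log ‖riemannZeta (1 + s)‖))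
    (hb : Summable (fun j => c j / ‖q j‖ ^ 2)) {u : ℝ} (hu : 0 ≤ u) :
    (1 - exp (-u)) * (∑' n : ℕ, ArithmeticFunction.vonMangoldt n / (n * log n) *
        max (u - log n) 0 - u * log u - (eulerMascheroniConstant - 1) * u -
          eulerMascheroniConstant) +
      ∑' j, c j * ((1 - exp (-u)) * (zeroTerm (q j) u).re) = 0 := by
  set G : ℝ → ℝ := fun u => ∑' n : ℕ, ArithmeticFunction.vonMangoldt n / (n * log n) *
    max (u - log n) 0 with hG
  set Z : ℝ → ℝ := fun u => ∑' j, c j * ((1 - exp (-u)) * (zeroTerm (q j) u).re) with hZ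
  set S : ℝ → ℝ := fun s => eulerMascheroniConstant * s - log s - log ‖riemannZeta (1 + s)‖ with hSd
  have hGb : ∀ u, 0 ≤ u → |G u| ≤ _ := fun u hu => abs_tsum_le_mul_exp summable_two_mul_rpow
    (fun n u _ => abs_vonMangoldt_mul_max_le n u) hu
  have hGc : ContinuousOn G (Ici 0) := continuousOn_tsum_of_abs_le_mul_exp
    (fun n => by fun_prop) summable_two_mul_rpow (fun n u _ => abs_vonMangoldt_mul_max_le n u)
  have hjb : ∀ j u, 0 ≤ u → |c j * ((1 - exp (-u)) * (zeroTerm (q j) u).re)| ≤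
      c j / ‖q j‖ ^ 2 * exp (-(1 / 2) * u) := by
    intro j u hu
    rw [abs_mul, abs_of_nonneg (hc j), div_eq_mul_one_div, mul_assoc]
    exact mul_le_mul_of_nonneg_left (abs_one_sub_exp_mul_re_zeroTerm_le (hq j) hu) (hc j)
  have hjc : ∀ j, ContinuousOn (fun u => c j * ((1 - exp (-u)) * (zeroTerm (q j) u).re)) (Ici 0) :=
    fun j => continuousOn_const.mul (ContinuousOn.mul (by fun_prop)
      (Complex.continuous_re.comp_continuousOn (continuousOn_zeroTerm (hq j))))
  have hZc : ContinuousOn Z (Ici 0) := continuousOn_tsum_of_abs_le_mul_exp hjc hb hjb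
  have hZb : ∀ u, 0 ≤ u → |Z u| ≤ _ := fun u hu => abs_tsum_le_mul_exp hb hjb hu
  set A : ℝ → ℝ := fun u => G u - u * log u - (eulerMascheroniConstant - 1) * u -
    eulerMascheroniConstant with hA
  have hAL : ∀ s : ℝ, 1 ≤ s → HasLaplaceAt A s (-(S s / s ^ 2)) := by
    intro s hs
    have hs0 : 0 < s := by linarith
    refine ((((hasLaplaceAt_tsum_vonMangoldt hs).sub (hasLaplaceAt_mul_log hs0)).sub
      ((hasLaplaceAt_id hs0).const_mul (eulerMascheroniConstant - 1))).sub
      ((hasLaplaceAt_one hs0).const_mul eulerMascheroniConstant)).congr (fun u _ => ?_) ?_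
    · simp only [hA, hG, mul_one]
    · simp only [hSd]
      field_simp
      ring
  have hZL : ∀ s : ℝ, 1 ≤ s → HasLaplaceAt Z s (S s / s ^ 2 - S (s + 1) / (s + 1) ^ 2) := by
    intro s hs
    have hs0 : 0 < s := by linarith
    refine hasLaplaceAt_tsum (a := -(1 / 2)) (by linarith) hjc
      (fun j => ((hasLaplaceAt_re_zeroTerm (hq j) hs0).one_sub_exp_mul
        (hasLaplaceAt_re_zeroTerm (hq j) (s := s + 1) (by linarith))).const_mul (c j)) hb hjb ?_
    refine (((hS s hs0).div_const (s ^ 2)).sub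
      ((hS (s + 1) (by linarith)).div_const ((s + 1) ^ 2))).congr_fun fun j => ?_
    ring
  have hL : ∀ s : ℝ, 1 ≤ s → HasLaplaceAt (fun u => (1 - exp (-u)) * A u + Z u) s 0 := by
    intro s hs
    exact (((hAL s hs).one_sub_exp_mul (hAL (s + 1) (by linarith))).add (hZL s hs)).congr
      (fun _ _ => rfl) (by ring)
  refine eq_zero_of_integral_exp_mul_eq_zero (f := fun u => (1 - exp (-u)) * A u + Z u)
    ?_ ?_ ?_ ?_ hu
  · refine ContinuousOn.add (ContinuousOn.mul (by fun_prop) ?_) hZc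
    exact ((hGc.sub continuous_mul_log.continuousOn).sub (by fun_prop)).sub continuousOn_const
  · have h1 : Tendsto (fun u => exp (-u) * A u) atTop (𝓝 0) := by
      have e1 := tendsto_exp_neg_mul_of_abs_le (by norm_num) hGb
      have e2 := (tendsto_pow_mul_exp_neg_atTop_nhds_zero 1).const_mul (eulerMascheroniConstant - 1)
      have e3 := (tendsto_pow_mul_exp_neg_atTop_nhds_zero 0).const_mul eulerMascheroniConstant
      have e4 := ((e1.sub tendsto_exp_neg_mul_mul_log).sub e2).sub e3
      simp only [mul_zero, sub_zero] at e4
      refine e4.congr fun u => ?_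
      simp only [hA]
      ring
    have h2 : Tendsto (fun u => exp (-u) * Z u) atTop (𝓝 0) :=
      tendsto_exp_neg_mul_of_abs_le (by norm_num) hZb
    have h3 : Tendsto (fun u : ℝ => 1 - exp (-u)) atTop (𝓝 (1 - 0)) :=
      tendsto_exp_neg_atTop_nhds_zero.const_sub 1
    have h4 := (h3.mul h1).add h2
    simp only [mul_zero, add_zero] at h4
    refine h4.congr fun u => ?_
    ring
  · simpa using (hL 1 le_rfl).1
  · intro n
    have h := (hL (n + 1) (by have := n.cast_nonneg (α := ℝ); linarith)).2
    refine Eq.trans ?_ h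
    refine setIntegral_congr_fun measurableSet_Ioi fun u _ => ?_
    simp only
    rw [← mul_assoc, ← exp_nat_mul, ← exp_add]
    ring_nf

theorem tsum_vonMangoldt_max_eq_sum {x : ℝ} (hx : 0 < x) :
    ∑' n : ℕ, ArithmeticFunction.vonMangoldt n / (n * log n) * max (log x - log n) 0 =
      ∑ n ∈ Finset.Icc 2 ⌊x⌋₊, ArithmeticFunction.vonMangoldt n / (n * log n) * log (x / n) := by
  rw [tsum_eq_sum (s := Finset.Icc 2 ⌊x⌋₊)]
  · refine Finset.sum_congr rfl fun n hn => ?_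
    obtain ⟨h1, h2⟩ := Finset.mem_Icc.1 hn
    have hn0 : (0 : ℝ) < n := by exact_mod_cast (by omega : 0 < n)
    have hnx : (n : ℝ) ≤ x := (Nat.le_floor_iff hx.le).1 h2
    rw [log_div hx.ne' hn0.ne', max_eq_left (sub_nonneg.2 (log_le_log hn0 hnx))]
  · intro n hn
    by_cases h2 : n < 2
    · interval_cases n <;> simp
    · have h3 : ⌊x⌋₊ < n := by
        by_contra h
        exact hn (Finset.mem_Icc.2 ⟨by omega, by omega⟩)
      have h4 : x < n := (Nat.floor_lt hx.le).1 h3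
      rw [max_eq_right (sub_nonpos.2 (log_le_log hx h4.le)), mul_zero]

theorem abs_tsum_zeroTerm_le {J : Type*} {c : J → ℝ} {q : J → ℂ}
    (hc : ∀ j, 0 ≤ c j) (hq : ∀ j, 1 / 2 ≤ (q j).re)
    (hb : Summable (fun j => c j / ‖q j‖ ^ 2)) {x : ℝ} (hx : 1 < x) :
    |∑' j, c j * (zeroTerm (q j) (log x)).re| ≤
      (∑' j, c j / ‖q j‖ ^ 2 * x ^ (-(q j).re)) / log x := by
  have hx0 : 0 < x := by linarith
  have hu : 0 < log x := log_pos hx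
  have hs : Summable (fun j => c j / ‖q j‖ ^ 2 * x ^ (-(q j).re)) := by
    refine Summable.of_nonneg_of_le
      (fun j => mul_nonneg (div_nonneg (hc j) (by positivity)) (by positivity)) (fun j => ?_) hb
    refine mul_le_of_le_one_right (div_nonneg (hc j) (by positivity)) ?_
    exact rpow_le_one_of_one_le_of_nonpos hx.le (by linarith [hq j])
  rw [← tsum_div_const]
  refine tsum_of_norm_bounded (f := fun j => c j * (zeroTerm (q j) (log x)).re)
    (hs.div_const _).hasSum fun j => ?_
  rw [norm_mul, norm_of_nonneg (hc j)]
  calc _ ≤ c j * (exp (-((q j).re * log x)) / (‖q j‖ ^ 2 * log x)) :=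
        mul_le_mul_of_nonneg_left
          ((Complex.abs_re_le_norm _).trans (norm_zeroTerm_le (hq j) hu)) (hc j)
    _ = _ := by
      rw [rpow_def_of_pos hx0]
      field_simp

end

/-- Lemma 3.6 (Lamzouri–Li–Soundararajan, Lemma 2.6): assuming RH, with
`B = (1/2)log(4π) − 1 − γ/2`, for every real `x ≥ e`,
`|∑_{n ≤ x} (Λ(n)/(n log n))·(log(x/n)/log x) − (log log x + γ − 1 + γ/log x)|
  ≤ 2|B|/(√x log²x) + 1/(3x³ log²x)`. -/
theorem stmt_15
    (RH : ∀ s : ℂ, riemannZeta s = 0 → 0 < s.re → s.re < 1 → s.re = 1 / 2)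
    (B : ℝ)
    (hB : B = (1 / 2) * Real.log (4 * Real.pi) - 1 - Real.eulerMascheroniConstant / 2)
    (x : ℝ) (hx : Real.exp 1 ≤ x) :
    |(∑ n ∈ Finset.Icc 2 ⌊x⌋₊, (Λ n / (n * Real.log n)) * (Real.log (x / n) / Real.log x))
        - (Real.log (Real.log x) + Real.eulerMascheroniConstant - 1
            + Real.eulerMascheroniConstant / Real.log x)|
      ≤ 2 * |B| / (Real.sqrt x * (Real.log x) ^ 2)
        + 1 / (3 * x ^ 3 * (Real.log x) ^ 2) := by
  have h1x : 1 < x := lt_of_lt_of_le (by simp) hx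
  have hx0 : 0 < x := by linarith
  have hu : 1 ≤ Real.log x := (Real.le_log_iff_exp_le hx0).2 hx
  have hu0 : 0 < Real.log x := by linarith
  obtain ⟨J, hJ, c, q, hc, hq, hS, hb, hbd⟩ := exists_hasSum_log_zeta RH hB
  have hE := tsum_vonMangoldt_explicit hc hq hS hb hu0.le
  simp only [mul_left_comm (c _) (1 - Real.exp _)] at hE
  rw [tsum_mul_left, ← mul_add] at hE
  have hne : 1 - Real.exp (-Real.log x) ≠ 0 := by
    have : Real.exp (-Real.log x) < 1 := by rw [Real.exp_lt_one_iff]; linarith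
    linarith
  have hE := (mul_eq_zero.1 hE).resolve_left hne
  rw [tsum_vonMangoldt_max_eq_sum hx0] at hE
  have hsum : ∑ n ∈ Finset.Icc 2 ⌊x⌋₊, (ArithmeticFunction.vonMangoldt n / (n * Real.log n)) *
      (Real.log (x / n) / Real.log x) = (∑ n ∈ Finset.Icc 2 ⌊x⌋₊,
        ArithmeticFunction.vonMangoldt n / (n * Real.log n) * Real.log (x / n)) / Real.log x := by
    rw [Finset.sum_div]
    exact Finset.sum_congr rfl fun n _ => by ring
  rw [hsum]
  have hdiff : (∑ n ∈ Finset.Icc 2 ⌊x⌋₊, ArithmeticFunction.vonMangoldt n / (n * Real.log n) *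
      Real.log (x / n)) / Real.log x - (Real.log (Real.log x) + Real.eulerMascheroniConstant - 1
        + Real.eulerMascheroniConstant / Real.log x) =
      -(∑' j, c j * (zeroTerm (q j) (Real.log x)).re) / Real.log x := by
    rw [div_sub' hu0.ne']
    congr 1
    rw [mul_add, mul_div_cancel₀ _ hu0.ne']
    linarith
  rw [hdiff, abs_div, abs_neg, abs_of_pos hu0]
  calc _ ≤ (2 * |B| / Real.sqrt x + 1 / (3 * x ^ 3)) / Real.log x / Real.log x := by
        refine div_le_div_of_nonneg_right ?_ hu0.le
        refine (abs_tsum_zeroTerm_le hc hq hb h1x).trans ?_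
        exact div_le_div_of_nonneg_right (hbd x h1x.le) hu0.le
    _ = _ := by
      have := Real.sqrt_pos.2 hx0
      field_simp
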